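/- arXiv:2012.04255 — 2 statements merged into one kernel-verified Lean document; each statement's English description precedes it below -/
import Mathlib

section
/- The map Φ : (μ_{s₁}×⋯×μ_{s_n}) × (ℂˣ)^{k−n} → (ℂˣ)ᵏ defined by Φ(w,λ)_j = ∏_{i=1}^n w_i^{P'_{i,j}} · ∏_{l=1}^{k−n} λ_l^{P''_{l,j}} (for j = 1,…,k) is an injective group homomorphism whose image is exactly the group G. In particular, G is isomorphic as a group to μ_{s₁}×⋯×μ_{s_n}×(ℂˣ)^{k−n}, i.e. G is a quasitorus of dimension k−n. -/
open scoped BigOperators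

/-- The monomial map `g ↦ (∏ i, g i ^ A i j)_j` attached to an integer matrix `A`. -/
def Matrix.monomialMap {ι κ M : Type*} [Fintype ι] [CommGroup M]
    (A : Matrix ι κ ℤ) (g : ι → M) : κ → M :=
  fun j => ∏ i, g i ^ A i j

namespace Matrix

variable {ι κ τ M : Type*} [Fintype ι] [CommGroup M]

theorem monomialMap_map_mul (A : Matrix ι κ ℤ) (g h : ι → M) :
    A.monomialMap (g * h) = A.monomialMap g * A.monomialMap h := by
  funext j
  simp [monomialMap, mul_zpow, Finset.prod_mul_distrib]

theorem monomialMap_map_one (A : Matrix ι κ ℤ) : A.monomialMap (1 : ι → M) = 1 := by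
  funext j
  simp [monomialMap]

theorem monomialMap_one [DecidableEq ι] (g : ι → M) :
    (1 : Matrix ι ι ℤ).monomialMap g = g := by
  funext j
  rw [monomialMap, Finset.prod_eq_single j] <;> simp +contextual

theorem monomialMap_mul [Fintype κ] (A : Matrix ι κ ℤ) (B : Matrix κ τ ℤ) (g : ι → M) :
    (A * B).monomialMap g = B.monomialMap (A.monomialMap g) := by
  have zpow_sum (x : M) (f : κ → ℤ) : x ^ (∑ l, f l) = ∏ l, x ^ f l :=
    map_sum (zmultiplesHom (Additive M) (Additive.ofMul x)) f Finset.univ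
  funext j
  simp only [monomialMap, Matrix.mul_apply, zpow_sum, _root_.zpow_mul, ← Finset.prod_zpow]
  exact Finset.prod_comm

theorem monomialMap_bijective [DecidableEq ι] {A : Matrix ι ι ℤ} (hA : IsUnit A.det) :
    Function.Bijective (A.monomialMap : (ι → M) → ι → M) := by
  refine Function.bijective_iff_has_inverse.2 ⟨A⁻¹.monomialMap, fun g => ?_, fun g => ?_⟩
  · rw [← monomialMap_mul, A.mul_nonsing_inv hA, monomialMap_one]
  · rw [← monomialMap_mul, A.nonsing_inv_mul hA, monomialMap_one]

end Matrix

/-- The map Φ(w,λ)_j = ∏ᵢ wᵢ^{P'_{i,j}} · ∏ₗ λₗ^{P''_{l,j}} is an injective group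
homomorphism from (μ_{s₁}×⋯×μ_{s_n}) × (ℂˣ)^{k−n} onto the group G. -/
theorem stmt_0
    (n k : ℕ) (hn : 0 < n) (hnk : n ≤ k)
    (F : Matrix (Fin n) (Fin k) ℤ) (hF : F.rank = n)
    (P : Matrix (Fin k) (Fin k) ℤ) (hP : IsUnit P.det)
    (Q : Matrix (Fin n) (Fin n) ℤ) (hQ : IsUnit Q.det)
    (s : Fin n → ℤ) (hs : ∀ i, s i ≠ 0)
    (hSNF : ∀ (i : Fin k) (j : Fin n),
      (P * F.transpose * Q) i j = if (i : ℕ) = (j : ℕ) then s j else 0)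
    (P' : Matrix (Fin n) (Fin k) ℤ) (hP' : ∀ i j, P' i j = P (Fin.castLE hnk i) j)
    (P'' : Matrix (Fin (k - n)) (Fin k) ℤ)
    (hP'' : ∀ l j, P'' l j = P ⟨n + l.1, by have := l.2; omega⟩ j)
    (Φ : (Fin n → ℂˣ) × (Fin (k - n) → ℂˣ) → (Fin k → ℂˣ))
    (hΦ : ∀ p j, Φ p j = (∏ i, p.1 i ^ P' i j) * ∏ l, p.2 l ^ P'' l j)
    (D : Set ((Fin n → ℂˣ) × (Fin (k - n) → ℂˣ)))
    (hD : D = {p | ∀ i, p.1 i ^ s i = 1}) :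
    (∀ p ∈ D, ∀ q ∈ D, Φ (p * q) = Φ p * Φ q) ∧
    Set.InjOn Φ D ∧
    Φ '' D = {g : Fin k → ℂˣ | ∀ i, ∏ j, g j ^ F i j = 1} := by
  let e : Fin n ⊕ Fin (k - n) ≃ Fin k := finSumFinEquiv.trans (finCongr (by omega))
  let c : (Fin n → ℂˣ) × (Fin (k - n) → ℂˣ) → Fin k → ℂˣ :=
    fun p => Sum.elim p.1 p.2 ∘ e.symm
  have e_inl (i : Fin n) : e (Sum.inl i) = Fin.castLE hnk i := by ext; simp [e]
  have e_inr (l : Fin (k - n)) : e (Sum.inr l) = ⟨n + l.1, by have := l.2; omega⟩ := by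
    ext; simp [e]
  have c_inl (p) (i : Fin n) : c p (Fin.castLE hnk i) = p.1 i := by simp [c, ← e_inl]
  have c_inr (p) (l : Fin (k - n)) : c p ⟨n + l.1, by have := l.2; omega⟩ = p.2 l := by
    simp [c, ← e_inr]
  have c_mul (p q) : c (p * q) = c p * c q := by
    funext i
    rcases h : e.symm i with a | a <;> simp [c, h]
  have c_injective : Function.Injective c := by
    intro p q h
    have h' (x) : Sum.elim p.1 p.2 x = Sum.elim q.1 q.2 x := by
      simpa [c] using congrFun h (e x)
    exact Prod.ext (funext fun i => h' (Sum.inl i)) (funext fun l => h' (Sum.inr l))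
  have c_surjective : Function.Surjective c := by
    intro g
    refine ⟨(fun i => g (e (Sum.inl i)), fun l => g (e (Sum.inr l))), ?_⟩
    funext i
    obtain ⟨x, rfl⟩ := e.surjective i
    cases x <;> simp [c]
  have Φ_eq (p) : Φ p = P.monomialMap (c p) := by
    funext j
    rw [hΦ, Matrix.monomialMap, ← e.prod_comp, Fintype.prod_sum_type]
    simp [hP', hP'', e_inl, e_inr, c_inl, c_inr]
  have snf_apply (p) (j : Fin n) : (P * F.transpose * Q).monomialMap (c p) j = p.1 j ^ s j := by
    rw [Matrix.monomialMap, ← e.prod_comp, Fintype.prod_sum_type, Finset.prod_eq_single j,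
      Finset.prod_eq_one]
    · simp [hSNF, e_inl, c_inl]
    · intro l _
      have : n + (l : ℕ) ≠ j := by have := j.2; omega
      simp [hSNF, e_inr, this]
    · intro i _ hij
      simp [hSNF, e_inl, Fin.val_ne_of_ne hij]
    · simp
  have mem_iff (p) : p ∈ D ↔ ∀ i, ∏ j, Φ p j ^ F i j = 1 := by
    have h₁ : p ∈ D ↔ (P * F.transpose * Q).monomialMap (c p) = 1 := by
      simp [hD, funext_iff, snf_apply]
    have h₂ : (∀ i, ∏ j, Φ p j ^ F i j = 1) ↔ F.transpose.monomialMap (Φ p) = 1 := by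
      simp [funext_iff, Matrix.monomialMap]
    rw [h₁, h₂, Matrix.monomialMap_mul, Matrix.monomialMap_mul, ← Φ_eq]
    exact (Matrix.monomialMap_bijective hQ).injective.eq_iff' (Matrix.monomialMap_map_one Q)
  have Φ_bijective : Function.Bijective Φ := by
    rw [show Φ = P.monomialMap ∘ c from funext Φ_eq]
    exact (Matrix.monomialMap_bijective hP).comp ⟨c_injective, c_surjective⟩
  refine ⟨fun p _ q _ => ?_, Φ_bijective.injective.injOn, ?_⟩
  · rw [Φ_eq, Φ_eq, Φ_eq, c_mul, Matrix.monomialMap_map_mul]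
  · ext g
    obtain ⟨p, rfl⟩ := Φ_bijective.surjective g
    rw [Φ_bijective.injective.mem_set_image, mem_iff]
    rfl
end

section
/- (BKK theorem, generic root count.) Let 𝒜₁,…,𝒜_n be finite nonempty subsets of ℤⁿ such that the convex hull of the Minkowski sum 𝒜₁+⋯+𝒜_n has dimension n. Then there exists a nonzero polynomial D in the variables (c_{i,m})_{i=1,…,n; m∈𝒜ᵢ} with the following property: for every choice of coefficients c with D(c) ≠ 0, the solution set {t ∈ (ℂˣ)ⁿ : Σ_{m∈𝒜ᵢ} c_{i,m}·tᵐ = 0 for i = 1,…,n} is finite, its cardinality equals Σ_{∅≠S⊆{1,…,n}} (−1)^{n−|S|} · vol(conv(Σ_{i∈S} 𝒜_i)) (which is the mixed volume MV(𝒫₁,…,𝒫_n) of the Newton polytopes 𝒫_i = conv(𝒜_i), normalized so that it equals the generic root count), and at each solution the Jacobian matrix (∂f̂_i/∂t_j) of the system is invertible (all roots have multiplicity one). -/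
section GenericFibre

open Polynomial

variable {P R K B L k : Type*} [CommRing P] [CommRing R] [Field K] [CommRing B] [Field L] [Field k]
  [Algebra P R] [Algebra R K] [Algebra P B] [Algebra B L] [Algebra K L]
  [Algebra R L] [Algebra P L] [IsScalarTower P R L] [IsScalarTower R K L] [IsScalarTower P B L]

lemma eval₂_extend_eq (e : P →+* k) (M : Submonoid P) (hM : ∀ m ∈ M, e m ≠ 0)
    [IsLocalization M R] (ê : R →+* k) (hê : ê.comp (algebraMap P R) = e)
    (hBL : Function.Injective (algebraMap B L)) (y b : B) (f : R[X])
    (hf : aeval (algebraMap B L y) f = algebraMap B L b)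
    (φ : B →+* k) (hφ : φ.comp (algebraMap P B) = e) :
    eval₂ ê (φ y) f = φ b := by
  obtain ⟨d, hd, hF⟩ := IsLocalization.integerNormalization_spec M f
  set F := IsLocalization.integerNormalization M f
  have h1 : aeval y F = algebraMap P B d * b := by
    apply hBL
    rw [← aeval_algebraMap_apply, ← aeval_map_algebraMap R, hF, map_mul, ← hf,
      ← algebraMap_smul R d f, map_smul, Algebra.smul_def, ← IsScalarTower.algebraMap_apply,
      ← IsScalarTower.algebraMap_apply]
  have h2 : eval₂ e (φ y) F = e d * φ b := by
    have := congrArg φ h1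
    rw [map_mul, aeval_def, hom_eval₂, hφ] at this
    rw [this, ← hφ]; rfl
  have h3 : eval₂ e (φ y) F = e d * eval₂ ê (φ y) f := by
    rw [← hê, ← eval₂_map, hF, ← algebraMap_smul R d f, eval₂_smul]; rfl
  exact mul_left_cancel₀ (hM d hd) (h3.symm.trans h2)

lemma natCard_extensions_eq [IsAlgClosed k] (e : P →+* k) (M : Submonoid P)
    (hM : ∀ m ∈ M, e m ≠ 0)
    [IsLocalization M R] (ê : R →+* k) (hê : ê.comp (algebraMap P R) = e)
    (hBL : Function.Injective (algebraMap B L)) (hRK : Function.Injective (algebraMap R K))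
    (y : B) (g : R[X]) (hg : g.Monic)
    (hgmin : g.map (algebraMap R K) = minpoly K (algebraMap B L y))
    (hsep : (g.map ê).Separable) (s : Set B) (hs : Algebra.adjoin P s = ⊤)
    (hgen : ∀ b ∈ s, ∃ h : R[X], aeval (algebraMap B L y) h = algebraMap B L b) :
    Nat.card {φ : B →+* k // φ.comp (algebraMap P B) = e} = g.natDegree := by
  classical
  have hroot : ∀ φ : {φ : B →+* k // φ.comp (algebraMap P B) = e},
      φ.1 y ∈ (g.map ê).roots.toFinset := by
    rintro ⟨φ, hφ⟩
    have := eval₂_extend_eq (L := L) e M hM ê hê hBL y 0 g (by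
      rw [← aeval_map_algebraMap K, hgmin, minpoly.aeval, map_zero]) φ hφ
    rw [Multiset.mem_toFinset, mem_roots hsep.ne_zero, IsRoot.def, eval_map, this, map_zero]
  have hcard : (g.map ê).roots.toFinset.card = g.natDegree := by
    rw [Multiset.toFinset_card_of_nodup (nodup_roots hsep), IsAlgClosed.card_roots_eq_natDegree,
      hg.natDegree_map]
  rw [← hcard, ← Nat.card_eq_finsetCard]
  refine Nat.card_congr (Equiv.ofBijective
    (fun φ => (⟨φ.1 y, hroot φ⟩ : (g.map ê).roots.toFinset)) ⟨?_, ?_⟩)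
  · rintro ⟨φ, hφ⟩ ⟨ψ, hψ⟩ h
    have hy : φ y = ψ y := congrArg Subtype.val h
    apply Subtype.ext
    let : Algebra P k := e.toAlgebra
    let φ' : B →ₐ[P] k := ⟨φ, fun r => RingHom.congr_fun hφ r⟩
    let ψ' : B →ₐ[P] k := ⟨ψ, fun r => RingHom.congr_fun hψ r⟩
    have : φ' = ψ' := by
      refine AlgHom.ext_of_adjoin_eq_top hs fun b hb => ?_
      obtain ⟨f, hf⟩ := hgen b hb
      have h1 := eval₂_extend_eq (L := L) e M hM ê hê hBL y b f hf φ hφ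
      have h2 := eval₂_extend_eq (L := L) e M hM ê hê hBL y b f hf ψ hψ
      change φ b = ψ b
      rw [← h1, ← h2, hy]
    exact congrArg AlgHom.toRingHom this
  · rintro ⟨x, hx⟩
    have hx' : eval₂ ê x g = 0 := by
      have := (mem_roots hsep.ne_zero).1 (Multiset.mem_toFinset.1 hx)
      rwa [IsRoot.def, eval_map] at this
    let θ := algebraMap B L y
    let a : R[X] →ₐ[R] L := aeval θ
    have hsurj : Function.Surjective a.rangeRestrict := a.rangeRestrict_surjective
    have hker : RingHom.ker (a.rangeRestrict : R[X] →+* a.range) ≤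
        RingHom.ker (eval₂RingHom ê x) := by
      intro h hh
      have h0 : aeval θ h = 0 := by
        have := congrArg Subtype.val (RingHom.mem_ker.1 hh)
        simpa using this
      rw [← aeval_map_algebraMap K] at h0
      have hdvd := minpoly.dvd K θ h0
      rw [← hgmin, map_dvd_map _ hRK hg] at hdvd
      obtain ⟨q, rfl⟩ := hdvd
      rw [RingHom.mem_ker, coe_eval₂RingHom, eval₂_mul, hx', zero_mul]
    let σ : a.range →+* k := RingHom.liftOfSurjective (a.rangeRestrict : R[X] →+* a.range) hsurj
      ⟨eval₂RingHom ê x, hker⟩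
    have hσ : ∀ f : R[X], σ (a.rangeRestrict f) = eval₂ ê x f := fun f => by
      have := RingHom.liftOfRightInverse_comp_apply (a.rangeRestrict : R[X] →+* a.range)
        (Function.surjInv hsurj) (Function.rightInverse_surjInv hsurj) ⟨eval₂RingHom ê x, hker⟩ f
      exact this
    have hmem : ∀ b : B, algebraMap B L b ∈ a.range.toSubring := by
      intro b
      have hb : b ∈ Algebra.adjoin P s := by rw [hs]; trivial
      induction hb using Algebra.adjoin_induction with
      | mem b hb =>
        obtain ⟨h, hh⟩ := hgen b hb
        exact ⟨h, hh⟩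
      | algebraMap r =>
        refine ⟨C (algebraMap P R r), ?_⟩
        change a (C _) = _
        simp only [a, aeval_C]
        rw [← IsScalarTower.algebraMap_apply, ← IsScalarTower.algebraMap_apply]
      | add b c _ _ hb hc => rw [map_add]; exact add_mem hb hc
      | mul b c _ _ hb hc => rw [map_mul]; exact mul_mem hb hc
    let φ : B →+* k := σ.comp ((algebraMap B L).codRestrict a.range.toSubring hmem)
    have hφ : φ.comp (algebraMap P B) = e := by
      ext r
      have : (algebraMap B L).codRestrict a.range.toSubring hmem (algebraMap P B r) =
          a.rangeRestrict (C (algebraMap P R r)) := by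
        apply Subtype.ext
        change algebraMap B L (algebraMap P B r) = a (C (algebraMap P R r))
        simp only [a, aeval_C]
        rw [← IsScalarTower.algebraMap_apply, ← IsScalarTower.algebraMap_apply]
      change σ ((algebraMap B L).codRestrict a.range.toSubring hmem (algebraMap P B r)) = e r
      rw [this, hσ, eval₂_C, ← hê]; rfl
    refine ⟨⟨φ, hφ⟩, Subtype.ext ?_⟩
    have : (algebraMap B L).codRestrict a.range.toSubring hmem y = a.rangeRestrict X := by
      apply Subtype.ext
      change algebraMap B L y = a X
      simp only [a, aeval_X, θ]
    change σ ((algebraMap B L).codRestrict a.range.toSubring hmem y) = x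
    rw [this, hσ, eval₂_X]

end GenericFibre

section GenericCard

open Polynomial
open nonZeroDivisors

lemma exists_denominator_lifts {P K : Type*} [CommRing P] [IsDomain P] [Field K] [Algebra P K]
    [IsFractionRing P K] (f : K[X]) :
    ∃ d : P, d ≠ 0 ∧ ∀ (M : Submonoid P) (hM : M ≤ P⁰), d ∈ M →
      f ∈ lifts (algebraMap (Localization.subalgebra.ofField K M hM) K) := by
  obtain ⟨d, hd, hF⟩ := IsLocalization.integerNormalization_spec P⁰ f
  refine ⟨d, nonZeroDivisors.ne_zero hd, fun M hM hdM => ?_⟩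
  rw [lifts_iff_coeff_lifts]
  intro i
  have hd0 : algebraMap P K d ≠ 0 :=
    IsFractionRing.to_map_ne_zero_of_mem_nonZeroDivisors hd
  refine ⟨⟨f.coeff i, ⟨(IsLocalization.integerNormalization P⁰ f).coeff i, d, hdM, ?_⟩⟩, rfl⟩
  have := congrArg (fun p => p.coeff i) hF
  simp only [coeff_map, coeff_smul] at this
  rw [this, Algebra.smul_def, eq_mul_inv_iff_mul_eq₀ hd0, mul_comm]

theorem exists_generic_natCard_extensions {P B : Type*} (k : Type*) [CommRing P] [IsDomain P]
    [CharZero P] [CommRing B] [IsDomain B] [Algebra P B] [FaithfulSMul P B]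
    [Algebra.IsAlgebraic P B] [Algebra.FiniteType P B] [Field k] [IsAlgClosed k] :
    ∃ D : P, D ≠ 0 ∧ ∃ N : ℕ, 0 < N ∧ ∀ e : P →+* k, e D ≠ 0 →
      Nat.card {φ : B →+* k // φ.comp (algebraMap P B) = e} = N := by
  classical
  let K := FractionRing P
  let L := FractionRing B
  let : Algebra K L := FractionRing.liftAlgebra P L
  have : Algebra.IsAlgebraic P L := (IsFractionRing.isAlgebraic_iff' P B L).1 inferInstance
  have : Algebra.IsAlgebraic K L :=
    (IsFractionRing.comap_isAlgebraic_iff (A := P) (K := K) (C := L)).1 inferInstance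
  have hBL : Function.Injective (algebraMap B L) := IsFractionRing.injective B L
  have : CharZero K := IsFractionRing.charZero_of_isFractionRing P
  obtain ⟨s, hs⟩ := Algebra.FiniteType.out (R := P) (A := B)
  have htop : IntermediateField.adjoin K (algebraMap B L '' (s : Set B)) = ⊤ := by
    have hB : ∀ b : B, algebraMap B L b ∈
        IntermediateField.adjoin K (algebraMap B L '' (s : Set B)) := by
      intro b
      have hb : b ∈ Algebra.adjoin P (s : Set B) := by rw [hs]; trivial
      induction hb using Algebra.adjoin_induction with
      | mem b hb => exact IntermediateField.subset_adjoin _ _ ⟨b, hb, rfl⟩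
      | algebraMap r =>
        rw [← IsScalarTower.algebraMap_apply, IsScalarTower.algebraMap_apply P K L]
        exact IntermediateField.algebraMap_mem _ _
      | add b c _ _ hb hc => rw [map_add]; exact add_mem hb hc
      | mul b c _ _ hb hc => rw [map_mul]; exact mul_mem hb hc
    rw [eq_top_iff]
    intro x _
    obtain ⟨a, b, -, rfl⟩ := IsFractionRing.div_surjective B x
    exact div_mem (hB a) (hB b)
  have : FiniteDimensional K L := by
    have : Finite (algebraMap B L '' (s : Set B)) := (s.finite_toSet.image _).to_subtype
    have : FiniteDimensional K (IntermediateField.adjoin K (algebraMap B L '' (s : Set B))) :=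
      IntermediateField.finiteDimensional_adjoin fun x _ => Algebra.IsIntegral.isIntegral x
    rw [htop] at this
    exact IntermediateField.topEquiv.toLinearEquiv.finiteDimensional
  obtain ⟨α, hα⟩ := Field.exists_primitive_element K L
  obtain ⟨a, b, hb, rfl⟩ := IsFractionRing.div_surjective B α
  obtain ⟨y, p, hp, hpy⟩ := Algebra.IsAlgebraic.exists_smul_eq_mul P a (nonZeroDivisors.ne_zero hb)
  let θ := algebraMap B L y
  have hb0 : algebraMap B L b ≠ 0 := IsFractionRing.to_map_ne_zero_of_mem_nonZeroDivisors hb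
  have hp0 : algebraMap P K p ≠ 0 :=
    IsFractionRing.to_map_ne_zero_of_mem_nonZeroDivisors (mem_nonZeroDivisors_of_ne_zero hp)
  have hpL : algebraMap K L (algebraMap P K p) ≠ 0 := by simpa using hp0
  have hθ : algebraMap B L a / algebraMap B L b = (algebraMap K L (algebraMap P K p))⁻¹ * θ := by
    have := congrArg (algebraMap B L) hpy
    rw [Algebra.smul_def, map_mul, map_mul, ← IsScalarTower.algebraMap_apply,
      IsScalarTower.algebraMap_apply P K L] at this
    rw [eq_inv_mul_iff_mul_eq₀ hpL, div_eq_mul_inv, ← mul_assoc, this]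
    rw [mul_right_comm, mul_inv_cancel₀ hb0, one_mul]
  have hθtop : IntermediateField.adjoin K {θ} = ⊤ := by
    rw [eq_top_iff, ← hα, IntermediateField.adjoin_simple_le_iff, hθ]
    exact mul_mem (inv_mem (IntermediateField.algebraMap_mem _ _))
      (IntermediateField.mem_adjoin_simple_self K θ)
  have hpoly : ∀ x : L, ∃ h : K[X], aeval θ h = x := by
    intro x
    have : x ∈ (IntermediateField.adjoin K {θ}).toSubalgebra := by rw [hθtop]; trivial
    rw [IntermediateField.adjoin_simple_toSubalgebra_of_isAlgebraic
      (Algebra.IsAlgebraic.isAlgebraic θ), Algebra.adjoin_singleton_eq_range_aeval] at this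
    exact this
  choose h hh using hpoly
  let g := minpoly K θ
  have hgm : g.Monic := minpoly.monic (Algebra.IsIntegral.isIntegral θ)
  obtain ⟨u, v, huv⟩ : g.Separable := Algebra.IsSeparable.isSeparable K θ
  choose d hd0 hd using fun f : K[X] => exists_denominator_lifts (P := P) f
  refine ⟨d g * d u * d v * ∏ b ∈ s, d (h (algebraMap B L b)), ?_, g.natDegree,
    minpoly.natDegree_pos (Algebra.IsIntegral.isIntegral θ), fun e he => ?_⟩
  · exact mul_ne_zero (mul_ne_zero (mul_ne_zero (hd0 _) (hd0 _)) (hd0 _))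
      (Finset.prod_ne_zero_iff.2 fun b _ => hd0 _)
  simp only [map_mul, map_prod, ne_eq, mul_eq_zero, not_or, Finset.prod_eq_zero_iff,
    not_exists, not_and] at he
  obtain ⟨⟨⟨heg, heu⟩, hev⟩, heh⟩ := he
  let M : Submonoid P := k⁰.comap e
  have hM' : ∀ m, m ∈ M ↔ e m ≠ 0 := fun m => mem_nonZeroDivisors_iff_ne_zero
  have hM : M ≤ P⁰ := fun m hm => mem_nonZeroDivisors_of_ne_zero fun h0 => by
    rw [hM', h0, map_zero] at hm; exact hm rfl
  let R := Localization.subalgebra.ofField K M hM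
  have hu : ∀ m : M, IsUnit (e m) := fun m => ((hM' m).1 m.2).isUnit
  let ê : R →+* k := IsLocalization.lift hu
  have hê : ê.comp (algebraMap P R) = e := IsLocalization.lift_comp hu
  have hRK : Function.Injective (algebraMap R K) := Subtype.val_injective
  obtain ⟨g', hg', hg'd, hg'm⟩ := lifts_and_natDegree_eq_and_monic
    (hd g M hM ((hM' _).2 heg)) hgm
  obtain ⟨u', hu'⟩ := (mem_lifts _).1 (hd u M hM ((hM' _).2 heu))
  obtain ⟨v', hv'⟩ := (mem_lifts _).1 (hd v M hM ((hM' _).2 hev))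
  have hsep : g'.Separable := by
    refine ⟨u', v', map_injective _ hRK ?_⟩
    rw [Polynomial.map_add, Polynomial.map_mul, Polynomial.map_mul, ← derivative_map, hg', hu', hv',
      huv, Polynomial.map_one]
  rw [← hg'd]
  refine natCard_extensions_eq (R := R) (K := K) (L := L) e M (fun m => (hM' m).1) ê hê hBL hRK y
    g' hg'm hg' hsep.map (s : Set B) hs fun b hb => ?_
  obtain ⟨h', hh'⟩ := (mem_lifts _).1 (hd (h (algebraMap B L b)) M hM ((hM' _).2 (heh b hb)))
  refine ⟨h', ?_⟩
  rw [← aeval_map_algebraMap K, hh', hh]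

lemma exists_norm_multiple {P B : Type*} [CommRing P] [CommRing B] [IsDomain B] [Algebra P B]
    [Algebra.IsAlgebraic P B] {b : B} (hb : b ≠ 0) :
    ∃ D : P, D ≠ 0 ∧ ∃ b' : B, algebraMap P B D = b * b' := by
  obtain ⟨b', D, hD, h⟩ := Algebra.IsAlgebraic.exists_smul_eq_mul P (1 : B) hb
  exact ⟨D, hD, b', by rw [← h, Algebra.smul_def, mul_one]⟩

end GenericCard

section LaurentSystem

variable {n : ℕ} {κ : Fin n → Type} [∀ i, Fintype (κ i)]

/-- The Laurent monomial `t ^ m`. -/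
noncomputable def laurentMonomial (t : Fin n → ℂˣ) (m : Fin n → ℤ) : ℂ :=
  ((∏ j, t j ^ m j : ℂˣ) : ℂ)

/-- The roots in the torus of the system `b i + ∑ k, c i k * t ^ q i k = 0`. -/
def sparseRoots (q : ∀ i, κ i → Fin n → ℤ) (c : ∀ i, κ i → ℂ) (b : Fin n → ℂ) :
    Set (Fin n → ℂˣ) :=
  {t | ∀ i, b i + ∑ k, c i k * laurentMonomial t (q i k) = 0}

/-- The logarithmic Jacobian matrix of a sparse system. -/
noncomputable def logJacobian (q : ∀ i, κ i → Fin n → ℤ) (c : ∀ i, κ i → ℂ) (t : Fin n → ℂˣ) :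
    Matrix (Fin n) (Fin n) ℂ :=
  Matrix.of fun i j => ∑ k, c i k * q i k j * laurentMonomial t (q i k)

/-- All coefficients of a sparse system, constant terms included, as a single family. -/
def sparseCoeffs (c : ∀ i, κ i → ℂ) (b : Fin n → ℂ) : (Σ i, κ i) ⊕ Fin n → ℂ :=
  Sum.elim (fun p => c p.1 p.2) b

/-- The incidence ring of a sparse system: Laurent polynomials in `t` over polynomials in the
nonconstant coefficients. -/
abbrev IncidenceRing (κ : Fin n → Type) : Type :=
  AddMonoidAlgebra (MvPolynomial (Σ i, κ i) ℂ) (Fin n → ℤ)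

/-- The point evaluation of the incidence ring at `(c, t)`. -/
noncomputable def incidenceEval (c : ∀ i, κ i → ℂ) (t : Fin n → ℂˣ) : IncidenceRing κ →+* ℂ :=
  AddMonoidAlgebra.liftNCRingHom (MvPolynomial.eval fun p => c p.1 p.2)
    { toFun := fun m => laurentMonomial t m.toAdd
      map_one' := by simp [laurentMonomial]
      map_mul' := fun a b => by simp [laurentMonomial, zpow_add, Finset.prod_mul_distrib] }
    fun _ _ => Commute.all _ _

omit [∀ i, Fintype (κ i)] in
lemma incidenceEval_single (c : ∀ i, κ i → ℂ) (t : Fin n → ℂˣ) (m : Fin n → ℤ)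
    (r : MvPolynomial (Σ i, κ i) ℂ) :
    incidenceEval c t (AddMonoidAlgebra.single m r) =
      MvPolynomial.eval (fun p => c p.1 p.2) r * laurentMonomial t m := by
  simp [incidenceEval, AddMonoidAlgebra.liftNCRingHom]

/-- The comorphism of the projection from the incidence variety to the space of coefficients. -/
noncomputable def incidenceMap (q : ∀ i, κ i → Fin n → ℤ) :
    MvPolynomial ((Σ i, κ i) ⊕ Fin n) ℂ →ₐ[ℂ] IncidenceRing κ :=
  MvPolynomial.aeval (Sum.elim (fun p => AddMonoidAlgebra.single 0 (MvPolynomial.X p))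
    fun i => ∑ k, AddMonoidAlgebra.single (q i k) (-MvPolynomial.X ⟨i, k⟩))

lemma incidenceEval_comp (q : ∀ i, κ i → Fin n → ℤ) (c : ∀ i, κ i → ℂ) (b : Fin n → ℂ)
    {t : Fin n → ℂˣ} (ht : t ∈ sparseRoots q c b) :
    (incidenceEval c t).comp (incidenceMap q : _ →+* IncidenceRing κ) =
      MvPolynomial.eval (sparseCoeffs c b) := by
  apply MvPolynomial.ringHom_ext
  · intro r
    simp [incidenceMap, AddMonoidAlgebra.coe_algebraMap, incidenceEval_single, laurentMonomial]
  · rintro (p | i)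
    · simp [incidenceMap, incidenceEval_single, laurentMonomial, sparseCoeffs]
    · have := ht i
      simp only [RingHom.comp_apply, AlgHom.coe_toRingHom, incidenceMap, MvPolynomial.aeval_X,
        Sum.elim_inr, map_neg, map_sum, incidenceEval_single, MvPolynomial.eval_X, sparseCoeffs,
        neg_mul, Finset.sum_neg_distrib]
      linear_combination -this

lemma exists_incidenceEval_eq (q : ∀ i, κ i → Fin n → ℤ) (c : ∀ i, κ i → ℂ) (b : Fin n → ℂ)
    (φ : IncidenceRing κ →+* ℂ)
    (hφ : φ.comp (incidenceMap q : _ →+* IncidenceRing κ) =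
      MvPolynomial.eval (sparseCoeffs c b)) :
    ∃ t ∈ sparseRoots q c b, incidenceEval c t = φ := by
  let χ : Multiplicative (Fin n → ℤ) →* ℂˣ :=
    ((φ : IncidenceRing κ →* ℂ).comp (AddMonoidAlgebra.of _ _)).toHomUnits
  have hχ : ∀ m : Fin n → ℤ, (χ (.ofAdd m) : ℂ) = φ (AddMonoidAlgebra.single m 1) := fun m => rfl
  let t : Fin n → ℂˣ := fun j => χ (.ofAdd (Pi.single j 1))
  have ht : ∀ m, laurentMonomial t m = φ (AddMonoidAlgebra.single m 1) := by
    intro m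
    rw [← hχ, laurentMonomial]
    congr 1
    simp only [t, ← map_zpow, ← map_prod]
    congr 1
    apply Multiplicative.toAdd.injective
    simp only [toAdd_prod, toAdd_zpow, toAdd_ofAdd]
    ext j
    simp [Finset.sum_apply, Pi.single_apply]
  have hC : ∀ r, MvPolynomial.eval (fun p : (Σ i, κ i) => c p.1 p.2) r =
      φ (AddMonoidAlgebra.single 0 r) := by
    have : MvPolynomial.eval (fun p : (Σ i, κ i) => c p.1 p.2) =
        φ.comp AddMonoidAlgebra.singleZeroRingHom := by
      apply MvPolynomial.ringHom_ext
      · intro r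
        have := RingHom.congr_fun hφ (MvPolynomial.C r)
        simp only [RingHom.comp_apply, AlgHom.coe_toRingHom, incidenceMap, MvPolynomial.eval_C,
          MvPolynomial.aeval_C] at this
        simp only [MvPolynomial.eval_C]
        exact this.symm
      · intro p
        have := RingHom.congr_fun hφ (MvPolynomial.X (Sum.inl p))
        simp only [RingHom.comp_apply, AlgHom.coe_toRingHom, incidenceMap, MvPolynomial.eval_X,
          MvPolynomial.aeval_X, Sum.elim_inl, sparseCoeffs] at this
        simp only [MvPolynomial.eval_X]
        exact this.symm
    exact fun r => RingHom.congr_fun this r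
  have hφt : incidenceEval c t = φ := by
    apply AddMonoidAlgebra.ringHom_ext
    · intro r
      rw [incidenceEval_single, hC]
      simp [laurentMonomial]
    · intro m
      rw [incidenceEval_single, ht, map_one, one_mul]
  refine ⟨t, fun i => ?_, hφt⟩
  have := RingHom.congr_fun hφ (MvPolynomial.X (Sum.inr i))
  rw [← hφt] at this
  simp only [RingHom.comp_apply, AlgHom.coe_toRingHom, incidenceMap, MvPolynomial.aeval_X,
    Sum.elim_inr, map_neg, map_sum, incidenceEval_single, MvPolynomial.eval_X, sparseCoeffs,
    neg_mul, Finset.sum_neg_distrib] at this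
  linear_combination -this

omit [∀ i, Fintype (κ i)] in
lemma incidenceEval_injective (c : ∀ i, κ i → ℂ) {s t : Fin n → ℂˣ}
    (h : incidenceEval c s = incidenceEval c t) : s = t := by
  ext j
  have := RingHom.congr_fun h (AddMonoidAlgebra.single (Pi.single j 1) 1)
  simpa [incidenceEval_single, laurentMonomial, Pi.single_apply, Finset.prod_ite_eq] using this

omit [∀ i, Fintype (κ i)] in
lemma trdeg_incidenceRing_le :
    Algebra.trdeg ℂ (IncidenceRing κ) ≤ Cardinal.mk ((Σ i, κ i) ⊕ Fin n) := by
  let x : (Σ i, κ i) ⊕ Fin n → IncidenceRing κ :=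
    Sum.elim (fun p => AddMonoidAlgebra.single 0 (MvPolynomial.X p))
      fun j => AddMonoidAlgebra.single (Pi.single j 1) 1
  suffices Algebra.IsAlgebraic (Algebra.adjoin ℂ (Set.range x)) (IncidenceRing κ) from
    (Algebra.IsAlgebraic.trdeg_le_cardinalMk ℂ (Set.range x)).trans Cardinal.mk_range_le
  let A := Algebra.adjoin ℂ (Set.range x)
  have hmem : ∀ a ∈ A, IsAlgebraic A a := fun a ha => isAlgebraic_algebraMap (⟨a, ha⟩ : A)
  have hpow : ∀ j (a : ℕ), IsAlgebraic A
      (AddMonoidAlgebra.single (Pi.single j (a : ℤ)) 1 : IncidenceRing κ) := by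
    intro j a
    have := (hmem (x (Sum.inr j)) (Algebra.subset_adjoin ⟨_, rfl⟩)).pow a
    simp only [x, Sum.elim_inr, AddMonoidAlgebra.single_pow, one_pow] at this
    rwa [← Pi.single_smul, nsmul_one] at this
  have hzpow : ∀ j (a : ℤ), IsAlgebraic A
      (AddMonoidAlgebra.single (Pi.single j a) 1 : IncidenceRing κ) := by
    intro j a
    obtain ⟨m, rfl | rfl⟩ := a.eq_nat_or_neg
    · exact hpow j m
    · refine IsAlgebraic.of_mul (mem_nonZeroDivisors_of_ne_zero ?_) (hpow j m) ?_
      · simp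
      · rw [AddMonoidAlgebra.single_mul_single, ← Pi.single_add, add_neg_cancel, Pi.single_zero,
          mul_one]
        exact isAlgebraic_one
  have hmon : ∀ m : Fin n → ℤ, IsAlgebraic A (AddMonoidAlgebra.single m 1 : IncidenceRing κ) := by
    intro m
    have : (AddMonoidAlgebra.single m 1 : IncidenceRing κ) =
        ∏ j, AddMonoidAlgebra.single (Pi.single j (m j)) 1 := by
      rw [AddMonoidAlgebra.prod_single, Finset.univ_sum_single, Finset.prod_const_one]
    rw [this, ← Subalgebra.mem_algebraicClosure]
    exact prod_mem fun j _ => hzpow j (m j)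
  have hcoeff : ∀ r : MvPolynomial (Σ i, κ i) ℂ,
      (AddMonoidAlgebra.single 0 r : IncidenceRing κ) ∈ A := by
    intro r
    induction r using MvPolynomial.induction_on with
    | C a => exact A.algebraMap_mem a
    | add p q hp hq => rw [AddMonoidAlgebra.single_add]; exact add_mem hp hq
    | mul_X p j hp =>
      rw [← add_zero (0 : Fin n → ℤ), ← AddMonoidAlgebra.single_mul_single]
      exact mul_mem hp (Algebra.subset_adjoin ⟨Sum.inl j, rfl⟩)
  refine ⟨fun f => ?_⟩
  induction f using AddMonoidAlgebra.induction_on with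
  | of m => exact hmon m
  | add f g hf hg => exact hf.add hg
  | smul r f hf =>
    rw [Algebra.smul_def]
    exact (hmem _ (hcoeff r)).mul hf

lemma incidenceMap_isAlgebraic (q : ∀ i, κ i → Fin n → ℤ)
    (hq : Function.Injective (incidenceMap q)) :
    @Algebra.IsAlgebraic _ _ _ _ (incidenceMap q).toRingHom.toAlgebra := by
  let _ : Algebra (MvPolynomial ((Σ i, κ i) ⊕ Fin n) ℂ) (IncidenceRing κ) :=
    (incidenceMap q).toRingHom.toAlgebra
  let x : (Σ i, κ i) ⊕ Fin n → IncidenceRing κ := fun p => incidenceMap q (MvPolynomial.X p)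
  have hx : MvPolynomial.aeval x = incidenceMap q := MvPolynomial.algHom_ext fun p => by simp [x]
  have hind : AlgebraicIndependent ℂ x := by
    rwa [algebraicIndependent_iff_injective_aeval, hx]
  have := (hind.isTranscendenceBasis_of_trdeg_le_of_finite trdeg_incidenceRing_le).isAlgebraic
  refine Algebra.IsAlgebraic.of_ringHom_of_comp_eq (S := Algebra.adjoin ℂ (Set.range x))
    hind.aevalEquiv (RingHom.id (IncidenceRing κ)) hind.aevalEquiv.surjective
    Function.injective_id ?_
  refine RingHom.ext fun p => ?_
  change ((hind.aevalEquiv p : Algebra.adjoin ℂ (Set.range x)) : IncidenceRing κ) =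
    incidenceMap q p
  rw [← hx]
  exact hind.algebraMap_aevalEquiv p

/-- The determinant of the logarithmic Jacobian, as an element of the incidence ring. -/
noncomputable def incidenceJacobian (q : ∀ i, κ i → Fin n → ℤ) : IncidenceRing κ :=
  (Matrix.of fun i j => ∑ k, AddMonoidAlgebra.single (q i k)
    ((q i k j : MvPolynomial (Σ i, κ i) ℂ) * MvPolynomial.X ⟨i, k⟩)).det

lemma incidenceEval_jacobian (q : ∀ i, κ i → Fin n → ℤ) (c : ∀ i, κ i → ℂ) (t : Fin n → ℂˣ) :
    incidenceEval c t (incidenceJacobian q) = (logJacobian q c t).det := by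
  rw [incidenceJacobian, RingHom.map_det]
  congr 1
  ext i j
  simp only [RingHom.mapMatrix_apply, Matrix.map_apply, Matrix.of_apply, map_sum,
    incidenceEval_single, logJacobian, map_mul, map_intCast, MvPolynomial.eval_X]
  exact Finset.sum_congr rfl fun k _ => by ring

theorem exists_generic_root_count (q : ∀ i, κ i → Fin n → ℤ) :
    ∃ D : MvPolynomial ((Σ i, κ i) ⊕ Fin n) ℂ, D ≠ 0 ∧ ∃ N : ℕ,
      (∀ c b, MvPolynomial.eval (sparseCoeffs c b) D ≠ 0 →
        (sparseRoots q c b).Finite ∧ (sparseRoots q c b).ncard = N) ∧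
      ((∀ c t, (logJacobian q c t).det = 0) ∨
        ∀ c b, MvPolynomial.eval (sparseCoeffs c b) D ≠ 0 →
          ∀ t ∈ sparseRoots q c b, (logJacobian q c t).det ≠ 0) := by
  by_cases hq : Function.Injective (incidenceMap q)
  swap
  · rw [injective_iff_map_eq_zero] at hq
    push Not at hq
    obtain ⟨D, hD, hD0⟩ := hq
    have : ∀ c b, MvPolynomial.eval (sparseCoeffs c b) D ≠ 0 → sparseRoots q c b = ∅ := by
      intro c b hcb
      by_contra! hne
      obtain ⟨t, ht⟩ := hne
      rw [← incidenceEval_comp q c b ht] at hcb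
      exact hcb (by simp [hD])
    refine ⟨D, hD0, 0, fun c b h => ?_, Or.inr fun c b h t ht => ?_⟩
    · simp [this c b h]
    · simp [this c b h] at ht
  let _ : Algebra (MvPolynomial ((Σ i, κ i) ⊕ Fin n) ℂ) (IncidenceRing κ) :=
    (incidenceMap q).toRingHom.toAlgebra
  have : FaithfulSMul (MvPolynomial ((Σ i, κ i) ⊕ Fin n) ℂ) (IncidenceRing κ) :=
    (faithfulSMul_iff_algebraMap_injective _ _).2 hq
  have : Algebra.IsAlgebraic (MvPolynomial ((Σ i, κ i) ⊕ Fin n) ℂ) (IncidenceRing κ) :=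
    incidenceMap_isAlgebraic q hq
  have : IsScalarTower ℂ (MvPolynomial ((Σ i, κ i) ⊕ Fin n) ℂ) (IncidenceRing κ) :=
    IsScalarTower.of_algebraMap_eq fun r => ((incidenceMap q).commutes r).symm
  have : Algebra.FiniteType ℂ (IncidenceRing κ) :=
    Algebra.FiniteType.trans (S := MvPolynomial (Σ i, κ i) ℂ) inferInstance inferInstance
  have : Algebra.FiniteType (MvPolynomial ((Σ i, κ i) ⊕ Fin n) ℂ) (IncidenceRing κ) :=
    Algebra.FiniteType.of_restrictScalars_finiteType ℂ _ _
  obtain ⟨D, hD0, N, hN, hD⟩ := exists_generic_natCard_extensions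
    (P := MvPolynomial ((Σ i, κ i) ⊕ Fin n) ℂ) (B := IncidenceRing κ) ℂ
  have hcount : ∀ c b, MvPolynomial.eval (sparseCoeffs c b) D ≠ 0 →
      (sparseRoots q c b).Finite ∧ (sparseRoots q c b).ncard = N := by
    intro c b h
    have hcard : (sparseRoots q c b).ncard = N := by
      rw [← hD _ h, ← Nat.card_coe_set_eq]
      refine Nat.card_congr (Equiv.ofBijective
        (fun t => ⟨incidenceEval c t.1, incidenceEval_comp q c b t.2⟩) ⟨?_, ?_⟩)
      · rintro ⟨s, hs⟩ ⟨t, ht⟩ hst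
        exact Subtype.ext (incidenceEval_injective c (congrArg Subtype.val hst))
      · rintro ⟨φ, hφ⟩
        obtain ⟨t, ht, rfl⟩ := exists_incidenceEval_eq q c b φ hφ
        exact ⟨⟨t, ht⟩, rfl⟩
    exact ⟨Set.finite_of_ncard_ne_zero (by omega), hcard⟩
  by_cases hJ : incidenceJacobian q = 0
  · refine ⟨D, hD0, N, hcount, Or.inl fun c t => ?_⟩
    rw [← incidenceEval_jacobian, hJ, map_zero]
  · obtain ⟨D', hD'0, b', hb'⟩ :=
      exists_norm_multiple (P := MvPolynomial ((Σ i, κ i) ⊕ Fin n) ℂ) hJ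
    refine ⟨D * D', mul_ne_zero hD0 hD'0, N, fun c b h => hcount c b ?_,
      Or.inr fun c b h t ht h0 => ?_⟩
    · rw [map_mul] at h
      exact left_ne_zero_of_mul h
    · rw [map_mul] at h
      refine right_ne_zero_of_mul h ?_
      rw [← incidenceEval_comp q c b ht]
      change incidenceEval c t (algebraMap _ _ D') = 0
      rw [hb', map_mul, incidenceEval_jacobian, h0, zero_mul]

end LaurentSystem

section Gibbs

open MeasureTheory

variable {n : ℕ} {ι : Type*} [Fintype ι]

/-- The dot product with `v` as a continuous linear form. -/
noncomputable def dotProductCLM (v : Fin n → ℝ) : (Fin n → ℝ) →L[ℝ] ℝ :=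
  LinearMap.toContinuousLinearMap (dotProductBilin ℝ ℝ v)

lemma dotProductCLM_apply (v x : Fin n → ℝ) : dotProductCLM v x = v ⬝ᵥ x := rfl

/-- The partition function of the exponential family supported on the points `p k`. -/
noncomputable def gibbsSum (p : ι → Fin n → ℝ) (x : Fin n → ℝ) : ℝ :=
  ∑ k, Real.exp (2 * (p k ⬝ᵥ x))

/-- The probability of the point `p k` in the exponential family with parameter `x`. -/
noncomputable def gibbs (p : ι → Fin n → ℝ) (x : Fin n → ℝ) (k : ι) : ℝ :=
  Real.exp (2 * (p k ⬝ᵥ x)) / gibbsSum p x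

/-- The mean of the exponential family with parameter `x`. -/
noncomputable def gibbsMean (p : ι → Fin n → ℝ) (x : Fin n → ℝ) : Fin n → ℝ :=
  fun j => ∑ k, gibbs p x k * p k j

/-- The covariance matrix of the exponential family with parameter `x`. -/
noncomputable def gibbsCov (p : ι → Fin n → ℝ) (x : Fin n → ℝ) : Matrix (Fin n) (Fin n) ℝ :=
  Matrix.of fun j l => ∑ k, gibbs p x k * p k j * p k l - gibbsMean p x j * gibbsMean p x l

lemma gibbsMean_dotProduct (p : ι → Fin n → ℝ) (x v : Fin n → ℝ) :
    gibbsMean p x ⬝ᵥ v = ∑ k, gibbs p x k * (p k ⬝ᵥ v) := by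
  simp only [dotProduct, gibbsMean, Finset.sum_mul, Finset.mul_sum]
  rw [Finset.sum_comm]
  simp only [mul_assoc]

lemma gibbsCov_mulVec (p : ι → Fin n → ℝ) (x v : Fin n → ℝ) (j : Fin n) :
    (gibbsCov p x).mulVec v j =
      ∑ k, gibbs p x k * p k j * (p k ⬝ᵥ v) - gibbsMean p x j * (gibbsMean p x ⬝ᵥ v) := by
  simp only [Matrix.mulVec, gibbsCov, dotProduct, Matrix.of_apply, sub_mul,
    Finset.sum_sub_distrib, Finset.sum_mul, Finset.mul_sum, mul_assoc]
  rw [Finset.sum_comm]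

lemma gibbsCov_isSymm (p : ι → Fin n → ℝ) (x : Fin n → ℝ) : (gibbsCov p x).IsSymm := by
  ext j l
  simp only [gibbsCov, Matrix.transpose_apply, Matrix.of_apply]
  congr 1
  · exact Finset.sum_congr rfl fun k _ => by ring
  · ring

variable [Nonempty ι]

lemma gibbsSum_pos (p : ι → Fin n → ℝ) (x : Fin n → ℝ) : 0 < gibbsSum p x :=
  Finset.sum_pos (fun _ _ => Real.exp_pos _) Finset.univ_nonempty

lemma gibbs_pos (p : ι → Fin n → ℝ) (x : Fin n → ℝ) (k : ι) : 0 < gibbs p x k :=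
  div_pos (Real.exp_pos _) (gibbsSum_pos p x)

lemma sum_gibbs (p : ι → Fin n → ℝ) (x : Fin n → ℝ) : ∑ k, gibbs p x k = 1 := by
  simp only [gibbs]
  rw [← Finset.sum_div]
  exact div_self (gibbsSum_pos p x).ne'

lemma gibbs_eq_exp (p : ι → Fin n → ℝ) (x : Fin n → ℝ) (k : ι) :
    gibbs p x k = Real.exp (2 * (p k ⬝ᵥ x) - Real.log (gibbsSum p x)) := by
  rw [Real.exp_sub, Real.exp_log (gibbsSum_pos p x), gibbs]

omit [Nonempty ι] in
lemma hasFDerivAt_two_dotProduct (v x : Fin n → ℝ) :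
    HasFDerivAt (fun x => 2 * (v ⬝ᵥ x)) ((2 : ℝ) • dotProductCLM v) x :=
  (dotProductCLM v).hasFDerivAt.const_mul 2

lemma hasFDerivAt_log_gibbsSum (p : ι → Fin n → ℝ) (x : Fin n → ℝ) :
    HasFDerivAt (fun x => Real.log (gibbsSum p x))
      ((2 : ℝ) • dotProductCLM (gibbsMean p x)) x := by
  have h : HasFDerivAt (gibbsSum p)
      (∑ k, Real.exp (2 * (p k ⬝ᵥ x)) • ((2 : ℝ) • dotProductCLM (p k))) x :=
    HasFDerivAt.fun_sum fun k _ => (hasFDerivAt_two_dotProduct (p k) x).exp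
  refine (h.log (gibbsSum_pos p x).ne').congr_fderiv (ContinuousLinearMap.ext fun v => ?_)
  simp only [smul_apply, dotProductCLM_apply, gibbsMean_dotProduct, sum_apply,
    smul_eq_mul, Finset.mul_sum, gibbs]
  exact Finset.sum_congr rfl fun k _ => by ring

lemma hasFDerivAt_gibbs (p : ι → Fin n → ℝ) (x : Fin n → ℝ) (k : ι) :
    HasFDerivAt (fun x => gibbs p x k)
      (gibbs p x k • ((2 : ℝ) • dotProductCLM (p k) -
        (2 : ℝ) • dotProductCLM (gibbsMean p x))) x := by
  have := ((hasFDerivAt_two_dotProduct (p k) x).sub (hasFDerivAt_log_gibbsSum p x)).exp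
  simp only [Pi.sub_apply, ← gibbs_eq_exp] at this
  exact this

lemma hasFDerivAt_gibbsMean (p : ι → Fin n → ℝ) (x : Fin n → ℝ) :
    HasFDerivAt (gibbsMean p)
      (LinearMap.toContinuousLinearMap (Matrix.toLin' ((2 : ℝ) • gibbsCov p x))) x := by
  rw [hasFDerivAt_pi']
  intro j
  have h := HasFDerivAt.fun_sum (u := Finset.univ)
    fun k _ => (hasFDerivAt_gibbs p x k).mul_const (p k j)
  refine h.congr_fderiv (ContinuousLinearMap.ext fun v => ?_)
  simp only [ContinuousLinearMap.comp_apply, ContinuousLinearMap.proj_apply,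
    LinearMap.coe_toContinuousLinearMap', Matrix.toLin'_apply, Matrix.smul_mulVec, Pi.smul_apply,
    gibbsCov_mulVec, sum_apply, smul_apply,
    sub_apply, dotProductCLM_apply, smul_eq_mul]
  rw [gibbsMean, Finset.sum_mul, ← Finset.sum_sub_distrib, Finset.mul_sum]
  exact Finset.sum_congr rfl fun k _ => by ring

lemma dotProduct_gibbsCov_mulVec (p : ι → Fin n → ℝ) (x v : Fin n → ℝ) :
    v ⬝ᵥ (gibbsCov p x).mulVec v =
      ∑ k, gibbs p x k * (p k ⬝ᵥ v - gibbsMean p x ⬝ᵥ v) ^ 2 := by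
  have h1 : v ⬝ᵥ (gibbsCov p x).mulVec v =
      ∑ k, gibbs p x k * (p k ⬝ᵥ v) ^ 2 - (gibbsMean p x ⬝ᵥ v) ^ 2 := by
    simp only [dotProduct, gibbsCov_mulVec, mul_sub, Finset.sum_sub_distrib]
    congr 1
    · simp only [Finset.mul_sum, sq]
      rw [Finset.sum_comm]
      refine Finset.sum_congr rfl fun k _ => ?_
      simp only [Finset.sum_mul, Finset.mul_sum]
      rw [Finset.sum_comm]
      exact Finset.sum_congr rfl fun _ _ => Finset.sum_congr rfl fun _ _ => by ring
    · rw [sq, Finset.sum_mul]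
      exact Finset.sum_congr rfl fun _ _ => by ring
  have h2 : ∀ k, gibbs p x k * (p k ⬝ᵥ v - gibbsMean p x ⬝ᵥ v) ^ 2 =
      gibbs p x k * (p k ⬝ᵥ v) ^ 2 - 2 * (gibbsMean p x ⬝ᵥ v) * (gibbs p x k * (p k ⬝ᵥ v)) +
        (gibbsMean p x ⬝ᵥ v) ^ 2 * gibbs p x k := fun k => by ring
  simp only [h2, Finset.sum_add_distrib, Finset.sum_sub_distrib, ← Finset.mul_sum, sum_gibbs,
    ← gibbsMean_dotProduct]
  rw [h1]
  ring

lemma gibbsCov_posSemidef (p : ι → Fin n → ℝ) (x : Fin n → ℝ) : (gibbsCov p x).PosSemidef := by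
  refine Matrix.PosSemidef.of_dotProduct_mulVec_nonneg ?_ fun v => ?_
  · rw [Matrix.IsHermitian, Matrix.conjTranspose_eq_transpose_of_trivial]
    exact gibbsCov_isSymm p x
  · rw [star_trivial, dotProduct_gibbsCov_mulVec]
    exact Finset.sum_nonneg fun k _ => mul_nonneg (gibbs_pos p x k).le (sq_nonneg _)

lemma gibbsMean_mem_convexHull (p : ι → Fin n → ℝ) (x : Fin n → ℝ) :
    gibbsMean p x ∈ convexHull ℝ (Set.range p) := by
  have : gibbsMean p x = ∑ k, gibbs p x k • p k := by
    ext j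
    simp [gibbsMean]
  rw [this]
  exact (convex_convexHull ℝ _).sum_mem (fun k _ => (gibbs_pos p x k).le) (sum_gibbs p x)
    fun k _ => subset_convexHull ℝ _ ⟨k, rfl⟩

omit [Nonempty ι] in
lemma dotProduct_le_log_gibbsSum (p : ι → Fin n → ℝ) (x : Fin n → ℝ) (k : ι) :
    p k ⬝ᵥ x ≤ Real.log (gibbsSum p x) / 2 := by
  have h : Real.exp (2 * (p k ⬝ᵥ x)) ≤ gibbsSum p x :=
    Finset.single_le_sum (f := fun k => Real.exp (2 * (p k ⬝ᵥ x)))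
      (fun _ _ => (Real.exp_pos _).le) (Finset.mem_univ k)
  have := Real.log_le_log (Real.exp_pos _) h
  rw [Real.log_exp] at this
  linarith

lemma continuous_gibbsCov (p : ι → Fin n → ℝ) : Continuous (gibbsCov p) := by
  have hg : ∀ k, Continuous fun x => gibbs p x k := fun k =>
    continuous_iff_continuousAt.2 fun x => (hasFDerivAt_gibbs p x k).continuousAt
  have hm : ∀ j, Continuous fun x => gibbsMean p x j := fun j =>
    continuous_finsetSum _ fun k _ => (hg k).mul continuous_const
  refine continuous_matrix fun j l => ?_
  exact (continuous_finsetSum _ fun k _ => ((hg k).mul continuous_const).mul continuous_const).sub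
    ((hm j).mul (hm l))

end Gibbs

section GibbsVolume

open MeasureTheory
open scoped Pointwise

variable {n : ℕ} {α : Type*} {ι : α → Type*} [∀ i, Fintype (ι i)] [∀ i, Nonempty (ι i)]

lemma sum_gibbsCov_posSemidef (S : Finset α) (p : ∀ i, ι i → Fin n → ℝ) (x : Fin n → ℝ) :
    (∑ i ∈ S, gibbsCov (p i) x).PosSemidef :=
  Matrix.posSemidef_sum S fun i _ => gibbsCov_posSemidef (p i) x

lemma dotProduct_sum_gibbsCov_mulVec (S : Finset α) (p : ∀ i, ι i → Fin n → ℝ)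
    (x v : Fin n → ℝ) :
    v ⬝ᵥ (∑ i ∈ S, gibbsCov (p i) x).mulVec v =
      ∑ i ∈ S, ∑ k, gibbs (p i) x k * (p i k ⬝ᵥ v - gibbsMean (p i) x ⬝ᵥ v) ^ 2 := by
  rw [Matrix.sum_mulVec, dotProduct_sum]
  exact Finset.sum_congr rfl fun i _ => dotProduct_gibbsCov_mulVec (p i) x v

lemma hasFDerivAt_sum_gibbsMean (S : Finset α) (p : ∀ i, ι i → Fin n → ℝ) (x : Fin n → ℝ) :
    HasFDerivAt (fun x => ∑ i ∈ S, gibbsMean (p i) x)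
      (LinearMap.toContinuousLinearMap
        (Matrix.toLin' ((2 : ℝ) • ∑ i ∈ S, gibbsCov (p i) x))) x := by
  refine (HasFDerivAt.fun_sum fun i _ => hasFDerivAt_gibbsMean (p i) x).congr_fderiv ?_
  rw [Finset.smul_sum, map_sum, map_sum]

lemma sum_gibbsMean_mem_convexHull (S : Finset α) (p : ∀ i, ι i → Fin n → ℝ) (x : Fin n → ℝ) :
    ∑ i ∈ S, gibbsMean (p i) x ∈ convexHull ℝ (∑ i ∈ S, Set.range (p i)) := by
  rw [convexHull_sum]
  exact Set.finsetSum_mem_finsetSum _ _ _ fun i _ => gibbsMean_mem_convexHull (p i) x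

/-- If the points are not all contained in translates of a common hyperplane, the sum of means
is injective. -/
lemma sum_gibbsMean_injective (S : Finset α) (p : ∀ i, ι i → Fin n → ℝ)
    (hp : ∀ v, (∀ i ∈ S, ∀ k l, p i k ⬝ᵥ v = p i l ⬝ᵥ v) → v = 0) :
    Function.Injective fun x => ∑ i ∈ S, gibbsMean (p i) x := by
  intro x y hxy
  by_contra hne
  let v := y - x
  have hv : v ≠ 0 := sub_ne_zero.2 (Ne.symm hne)
  let f : ℝ → ℝ := fun t => v ⬝ᵥ ∑ i ∈ S, gibbsMean (p i) (x + t • v)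
  have hf : ∀ t, HasDerivAt f
      (2 * (v ⬝ᵥ (∑ i ∈ S, gibbsCov (p i) (x + t • v)).mulVec v)) t := by
    intro t
    have h1 : HasDerivAt (fun t : ℝ => x + t • v) v t := by
      simpa using ((hasDerivAt_id t).smul_const v).const_add x
    have h2 := (dotProductCLM v).hasFDerivAt.comp_hasDerivAt t
      ((hasFDerivAt_sum_gibbsMean S p (x + t • v)).comp_hasDerivAt t h1)
    refine h2.congr_deriv ?_
    simp only [LinearMap.coe_toContinuousLinearMap', Matrix.toLin'_apply, Matrix.smul_mulVec,
      dotProductCLM_apply, dotProduct_smul, smul_eq_mul]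
  have hmono : StrictMono f := strictMono_of_deriv_pos fun t => by
    rw [(hf t).deriv, dotProduct_sum_gibbsCov_mulVec]
    refine mul_pos two_pos (lt_of_le_of_ne (Finset.sum_nonneg fun i _ => Finset.sum_nonneg
      fun k _ => mul_nonneg (gibbs_pos _ _ k).le (sq_nonneg _)) fun h0 => hv (hp v ?_))
    intro i hi
    have h1 := (Finset.sum_eq_zero_iff_of_nonneg fun i _ => Finset.sum_nonneg
      fun k _ => mul_nonneg (gibbs_pos _ _ k).le (sq_nonneg _)).1 h0.symm i hi
    have h2 : ∀ k, p i k ⬝ᵥ v = gibbsMean (p i) (x + t • v) ⬝ᵥ v := by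
      intro k
      have := (Finset.sum_eq_zero_iff_of_nonneg
        fun k _ => mul_nonneg (gibbs_pos _ _ k).le (sq_nonneg _)).1 h1 k (Finset.mem_univ k)
      rw [mul_eq_zero, or_iff_right (gibbs_pos _ _ k).ne', sq_eq_zero_iff, sub_eq_zero] at this
      exact this
    intro k l
    rw [h2 k, h2 l]
  have h01 : f 0 < f 1 := hmono one_pos
  simp only [f, zero_smul, add_zero, one_smul, v, add_sub_cancel] at h01
  exact h01.ne (congrArg (dotProduct v) hxy)

omit [∀ i, Nonempty (ι i)] in
lemma dotProduct_le_of_mem_convexHull_sum (S : Finset α) (p : ∀ i, ι i → Fin n → ℝ)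
    (x : Fin n → ℝ) {y : Fin n → ℝ} (hy : y ∈ convexHull ℝ (∑ i ∈ S, Set.range (p i))) :
    y ⬝ᵥ x ≤ ∑ i ∈ S, Real.log (gibbsSum (p i) x) / 2 := by
  have hconv : Convex ℝ {y : Fin n → ℝ | y ⬝ᵥ x ≤ ∑ i ∈ S, Real.log (gibbsSum (p i) x) / 2} :=
    convex_halfSpace_le (f := fun y => y ⬝ᵥ x)
      ⟨fun a b => add_dotProduct a b x, fun c a => smul_dotProduct c a x⟩ _
  refine convexHull_min ?_ hconv hy
  intro z hz
  obtain ⟨g, hg, rfl⟩ := (Set.mem_finsetSum S _ z).1 hz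
  rw [Set.mem_ofPred_eq, sum_dotProduct]
  refine Finset.sum_le_sum fun i hi => ?_
  obtain ⟨k, hk⟩ := hg hi
  rw [← hk]
  exact dotProduct_le_log_gibbsSum (p i) x k

lemma interior_convexHull_subset_range (S : Finset α) (p : ∀ i, ι i → Fin n → ℝ) :
    interior (convexHull ℝ (∑ i ∈ S, Set.range (p i))) ⊆
      Set.range fun x => ∑ i ∈ S, gibbsMean (p i) x := by
  intro y hy
  obtain ⟨ε, hε, hball⟩ := Metric.nhds_basis_closedBall.mem_iff.1 (mem_interior_iff_mem_nhds.1 hy)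
  let F : (Fin n → ℝ) → ℝ := fun x => ∑ i ∈ S, Real.log (gibbsSum (p i) x) / 2 - y ⬝ᵥ x
  have hF : ∀ x, HasFDerivAt F
      (dotProductCLM (∑ i ∈ S, gibbsMean (p i) x - y)) x := by
    intro x
    have h1 := (HasFDerivAt.fun_sum (u := S) fun i _ =>
      (hasFDerivAt_log_gibbsSum (p i) x).mul_const (2⁻¹ : ℝ)).sub (dotProductCLM y).hasFDerivAt
    refine h1.congr_fderiv (ContinuousLinearMap.ext fun v => ?_)
    simp [dotProductCLM_apply, sub_dotProduct, sum_dotProduct]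
  have hcont : Continuous F := continuous_iff_continuousAt.2 fun x => (hF x).continuousAt
  have hlow : ∀ x, ε * ‖x‖ ≤ F x := by
    intro x
    have hnonneg : 0 ≤ F x := by
      have := dotProduct_le_of_mem_convexHull_sum S p x (interior_subset hy)
      simp only [F]
      linarith
    suffices ‖x‖ ≤ F x / ε by rwa [le_div_iff₀ hε, mul_comm] at this
    refine (pi_norm_le_iff_of_nonneg (div_nonneg hnonneg hε.le)).2 fun j => ?_
    rw [le_div_iff₀ hε, Real.norm_eq_abs]
    have key : ∀ s : ℝ, |s| ≤ ε → s * x j ≤ F x := by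
      intro s hs
      have hmem : y + Pi.single j s ∈ Metric.closedBall y ε := by
        rw [mem_closedBall_iff_norm, add_sub_cancel_left, Pi.norm_single]
        exact hs
      have := dotProduct_le_of_mem_convexHull_sum S p x (hball hmem)
      rw [add_dotProduct, single_dotProduct] at this
      simp only [F]
      linarith
    have h1 := key ε (abs_of_pos hε).le
    have h2 := key (-ε) (by rw [abs_neg, abs_of_pos hε])
    rcases abs_cases (x j) with ⟨h, _⟩ | ⟨h, _⟩ <;> rw [h] <;> linarith
  have htend : Filter.Tendsto F (Filter.cocompact _) Filter.atTop :=
    Filter.tendsto_atTop_mono hlow ((tendsto_norm_cocompact_atTop).const_mul_atTop hε)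
  obtain ⟨x, hx⟩ := hcont.exists_forall_le htend
  have h0 := IsLocalMin.hasFDerivAt_eq_zero (Filter.Eventually.of_forall hx) (hF x)
  refine ⟨x, ?_⟩
  rw [← sub_eq_zero, ← dotProduct_self_eq_zero]
  exact DFunLike.congr_fun h0 _

lemma volume_interior_convex {s : Set (Fin n → ℝ)} (hs : Convex ℝ s) :
    volume (interior s) = volume s := by
  refine le_antisymm (measure_mono interior_subset) ?_
  calc volume s ≤ volume (interior s ∪ frontier s) := measure_mono fun x hx => by
        by_cases h : x ∈ interior s
        · exact Or.inl h
        · exact Or.inr ⟨subset_closure hx, h⟩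
    _ ≤ volume (interior s) + volume (frontier s) := measure_union_le _ _
    _ = volume (interior s) := by rw [hs.addHaar_frontier volume, add_zero]

theorem lintegral_det_sum_gibbsCov (S : Finset α) (p : ∀ i, ι i → Fin n → ℝ) :
    ∫⁻ x, ENNReal.ofReal ((2 : ℝ) • ∑ i ∈ S, gibbsCov (p i) x).det =
      volume (convexHull ℝ (∑ i ∈ S, Set.range (p i))) := by
  have hdet : ∀ x, 0 ≤ ((2 : ℝ) • ∑ i ∈ S, gibbsCov (p i) x).det := fun x => by
    rw [Matrix.det_smul]
    exact mul_nonneg (by positivity) (sum_gibbsCov_posSemidef S p x).det_nonneg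
  by_cases hp : ∀ v, (∀ i ∈ S, ∀ k l, p i k ⬝ᵥ v = p i l ⬝ᵥ v) → v = 0
  · have h := lintegral_abs_det_fderiv_eq_addHaar_image volume MeasurableSet.univ
      (fun x _ => (hasFDerivAt_sum_gibbsMean S p x).hasFDerivWithinAt)
      (sum_gibbsMean_injective S p hp).injOn
    rw [Set.image_univ, Measure.restrict_univ] at h
    rw [← volume_interior_convex (convex_convexHull ℝ _)]
    calc _ = volume (Set.range fun x => ∑ i ∈ S, gibbsMean (p i) x) := by
          rw [← h]
          refine lintegral_congr fun x => ?_
          rw [ContinuousLinearMap.det, LinearMap.coe_toContinuousLinearMap, LinearMap.det_toLin',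
            abs_of_nonneg (hdet x)]
      _ = _ := by
          refine le_antisymm ?_ (measure_mono (interior_convexHull_subset_range S p))
          rw [volume_interior_convex (convex_convexHull ℝ _)]
          refine measure_mono ?_
          rintro _ ⟨x, rfl⟩
          exact sum_gibbsMean_mem_convexHull S p x
  · push Not at hp
    obtain ⟨v, hv, hv0⟩ := hp
    have h0 : ∀ x, ((2 : ℝ) • ∑ i ∈ S, gibbsCov (p i) x).det = 0 := by
      intro x
      rw [← Matrix.exists_mulVec_eq_zero_iff]
      refine ⟨v, hv0, ?_⟩
      rw [Matrix.smul_mulVec, Matrix.sum_mulVec, Finset.sum_eq_zero, smul_zero]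
      intro i hi
      ext j
      rw [gibbsCov_mulVec]
      have hk : ∀ k, p i k ⬝ᵥ v = gibbsMean (p i) x ⬝ᵥ v := by
        intro k
        rw [gibbsMean_dotProduct, Finset.sum_congr rfl fun l _ => by rw [hv i hi l k],
          ← Finset.sum_mul, sum_gibbs, one_mul]
      simp only [hk, ← Finset.sum_mul]
      simp [gibbsMean]
    simp only [h0, ENNReal.ofReal_zero, lintegral_zero]
    rw [← volume_interior_convex (convex_convexHull ℝ _)]
    suffices interior (convexHull ℝ (∑ i ∈ S, Set.range (p i))) = ∅ by
      rw [this, measure_empty]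
    let g : ∀ i, ι i := fun i => Classical.arbitrary _
    have hplane : ∀ y ∈ convexHull ℝ (∑ i ∈ S, Set.range (p i)),
        y ⬝ᵥ v = ∑ i ∈ S, p i (g i) ⬝ᵥ v := by
      intro y hy
      refine convexHull_min ?_ (convex_hyperplane (f := fun y => y ⬝ᵥ v)
        ⟨fun a b => add_dotProduct a b v, fun c a => smul_dotProduct c a v⟩ _) hy
      intro z hz
      obtain ⟨f, hf, rfl⟩ := (Set.mem_finsetSum S _ z).1 hz
      rw [Set.mem_ofPred_eq, sum_dotProduct]
      refine Finset.sum_congr rfl fun i hi => ?_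
      obtain ⟨k, hk⟩ := hf hi
      rw [← hk]
      exact hv i hi _ _
    by_contra! hne
    obtain ⟨y, hy⟩ := hne
    have hcont : Filter.Tendsto (fun t : ℝ => y + t • v) (nhdsWithin 0 {0}ᶜ) (nhds y) := by
      have : Continuous fun t : ℝ => y + t • v := by fun_prop
      simpa using (this.tendsto 0).mono_left nhdsWithin_le_nhds
    obtain ⟨t, ht, ht0⟩ := ((hcont.eventually (isOpen_interior.mem_nhds hy)).and
      self_mem_nhdsWithin).exists
    have h1 := hplane _ (interior_subset ht)
    rw [add_dotProduct, hplane _ (interior_subset hy), smul_dotProduct, add_eq_left,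
      smul_eq_mul, mul_eq_zero, dotProduct_self_eq_zero] at h1
    exact h1.elim ht0 hv0

lemma integrable_det_sum_gibbsCov (S : Finset α) (p : ∀ i, ι i → Fin n → ℝ) :
    Integrable fun x => ((2 : ℝ) • ∑ i ∈ S, gibbsCov (p i) x).det := by
  have hcont : Continuous fun x => ((2 : ℝ) • ∑ i ∈ S, gibbsCov (p i) x).det :=
    ((continuous_finsetSum S fun i _ => continuous_gibbsCov (p i)).const_smul (2 : ℝ)).matrix_det
  refine ⟨hcont.aestronglyMeasurable, ?_⟩
  rw [hasFiniteIntegral_iff_ofReal (Filter.Eventually.of_forall fun x => ?_),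
    lintegral_det_sum_gibbsCov]
  · have hb : Bornology.IsBounded (∑ i ∈ S, Set.range (p i)) := by
      refine Set.Finite.isBounded ?_
      classical
      have : ∑ i ∈ S, Set.range (p i) =
          ((∑ i ∈ S, Finset.univ.image (p i) : Finset (Fin n → ℝ)) : Set (Fin n → ℝ)) := by
        rw [Finset.coe_sum]
        simp
      rw [this]
      exact Finset.finite_toSet _
    exact (isBounded_convexHull.2 hb).measure_lt_top
  · change 0 ≤ ((2 : ℝ) • ∑ i ∈ S, gibbsCov (p i) x).det
    rw [Matrix.det_smul]
    exact mul_nonneg (by positivity) (sum_gibbsCov_posSemidef S p x).det_nonneg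

theorem integral_det_sum_gibbsCov (S : Finset α) (p : ∀ i, ι i → Fin n → ℝ) :
    ∫ x, ((2 : ℝ) • ∑ i ∈ S, gibbsCov (p i) x).det =
      (volume (convexHull ℝ (∑ i ∈ S, Set.range (p i)))).toReal := by
  rw [integral_eq_lintegral_of_nonneg_ae, lintegral_det_sum_gibbsCov]
  · refine Filter.Eventually.of_forall fun x => ?_
    change 0 ≤ ((2 : ℝ) • ∑ i ∈ S, gibbsCov (p i) x).det
    rw [Matrix.det_smul]
    exact mul_nonneg (by positivity) (sum_gibbsCov_posSemidef S p x).det_nonneg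
  · exact (integrable_det_sum_gibbsCov S p).aestronglyMeasurable

end GibbsVolume

section GaussianMoments

open MeasureTheory Matrix

lemma integral_exp_neg_sq_complex : ∫ z : ℂ, ((Real.exp (-‖z‖ ^ 2) : ℝ) : ℂ) = Real.pi := by
  have := Complex.integral_exp_neg_rpow (p := 2) (by norm_num)
  rw [integral_complex_ofReal]
  norm_num at this
  rw [this]

lemma integral_normSq_mul_exp_neg_sq_complex :
    ∫ z : ℂ, ((‖z‖ ^ 2 * Real.exp (-‖z‖ ^ 2) : ℝ) : ℂ) = Real.pi := by
  have := Complex.integral_rpow_mul_exp_neg_rpow (p := 2) (q := 2) (by norm_num) (by norm_num)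
  rw [integral_complex_ofReal]
  norm_num at this
  rw [this]

/-- The one-variable factors of `b k * conj (b l) * exp (-∑ ‖b‖ ^ 2)`. -/
noncomputable def gaussianFactor (x y : Prop) [Decidable x] [Decidable y] (z : ℂ) : ℂ :=
  (if x then z else 1) * (if y then star z else 1) * (Real.exp (-‖z‖ ^ 2) : ℝ)

lemma continuous_gaussianFactor (x y : Prop) [Decidable x] [Decidable y] :
    Continuous (gaussianFactor x y) := by
  unfold gaussianFactor
  split_ifs <;> fun_prop

lemma integrable_gaussianFactor (x y : Prop) [Decidable x] [Decidable y] :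
    Integrable (gaussianFactor x y) := by
  have hpi : ((Real.pi : ℝ) : ℂ) ≠ 0 := by exact_mod_cast Real.pi_ne_zero
  have h0 : Integrable fun z : ℂ => ((Real.exp (-‖z‖ ^ 2) : ℝ) : ℂ) :=
    .of_integral_ne_zero (by rw [integral_exp_neg_sq_complex]; exact hpi)
  have h2 : Integrable fun z : ℂ => ((‖z‖ ^ 2 * Real.exp (-‖z‖ ^ 2) : ℝ) : ℂ) :=
    .of_integral_ne_zero (by rw [integral_normSq_mul_exp_neg_sq_complex]; exact hpi)
  refine (h0.norm.add h2.norm).mono' (continuous_gaussianFactor x y).aestronglyMeasurable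
    (.of_forall fun z => ?_)
  have hz := norm_nonneg z
  have he := Real.exp_pos (-‖z‖ ^ 2)
  have e1 : ‖((Real.exp (-‖z‖ ^ 2) : ℝ) : ℂ)‖ = Real.exp (-‖z‖ ^ 2) := by
    rw [Complex.norm_real, Real.norm_of_nonneg he.le]
  have e2 : ‖((‖z‖ ^ 2 * Real.exp (-‖z‖ ^ 2) : ℝ) : ℂ)‖ = ‖z‖ ^ 2 * Real.exp (-‖z‖ ^ 2) := by
    rw [Complex.norm_real, Real.norm_of_nonneg (by positivity)]
  simp only [Pi.add_apply, gaussianFactor, norm_mul, e1, e2, ← one_add_mul]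
  refine mul_le_mul_of_nonneg_right ?_ he.le
  split_ifs <;> simp only [norm_star, norm_one] <;> nlinarith

lemma integral_gaussianFactor (x y : Prop) [Decidable x] [Decidable y] :
    ∫ z, gaussianFactor x y z = if x ↔ y then (Real.pi : ℂ) else 0 := by
  by_cases hx : x <;> by_cases hy : y
  · simp only [gaussianFactor, hx, hy, if_true]
    rw [← integral_normSq_mul_exp_neg_sq_complex]
    congr 1 with z
    push_cast
    rw [Complex.star_def, Complex.mul_conj']
  · simp only [hx, hy, iff_false, not_true, if_false]
    have := integral_neg_eq_self (gaussianFactor x y) volume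
    simp only [gaussianFactor, hx, hy, if_true, if_false, norm_neg, neg_mul, integral_neg] at this ⊢
    exact self_eq_neg.1 this.symm
  · simp only [hx, hy, false_iff, not_true, if_false]
    have := integral_neg_eq_self (gaussianFactor x y) volume
    simp only [gaussianFactor, hx, hy, if_true, if_false, norm_neg, star_neg, mul_neg, neg_mul,
      integral_neg] at this ⊢
    exact self_eq_neg.1 this.symm
  · simp only [gaussianFactor, hx, hy, if_false, one_mul, if_true]
    exact integral_exp_neg_sq_complex

variable {κ : Type*} [Fintype κ]

lemma mul_star_mul_gaussian_eq [DecidableEq κ] (k l : κ) (b : κ → ℂ) :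
    b k * star (b l) * (Real.exp (-∑ m, ‖b m‖ ^ 2) : ℝ) =
      ∏ m, gaussianFactor (m = k) (m = l) (b m) := by
  simp only [gaussianFactor, Finset.prod_mul_distrib, Finset.prod_ite_eq', Finset.mem_univ, if_true]
  rw [← Finset.sum_neg_distrib, Real.exp_sum]
  push_cast
  rfl

lemma dotProduct_mul_star_mul_gaussian_eq [DecidableEq κ] (p q b : κ → ℂ) :
    (p ⬝ᵥ b) * star (q ⬝ᵥ b) * (Real.exp (-∑ m, ‖b m‖ ^ 2) : ℝ) =
      ∑ k, ∑ l, p k * star (q l) * ∏ m, gaussianFactor (m = k) (m = l) (b m) := by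
  simp only [← mul_star_mul_gaussian_eq, dotProduct, star_sum, star_mul']
  rw [Finset.sum_mul_sum, Finset.sum_mul]
  refine Finset.sum_congr rfl fun k _ => ?_
  rw [Finset.sum_mul]
  exact Finset.sum_congr rfl fun l _ => by ring

lemma integrable_dotProduct_mul_star_mul_gaussian (p q : κ → ℂ) :
    Integrable fun b : κ → ℂ =>
      (p ⬝ᵥ b) * star (q ⬝ᵥ b) * (Real.exp (-∑ m, ‖b m‖ ^ 2) : ℝ) := by
  classical
  simp only [dotProduct_mul_star_mul_gaussian_eq]
  exact integrable_finsetSum _ fun k _ => integrable_finsetSum _ fun l _ =>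
    (Integrable.fintype_prod_dep fun m => integrable_gaussianFactor _ _).const_mul _

lemma integral_dotProduct_mul_star_mul_gaussian (p q : κ → ℂ) :
    ∫ b : κ → ℂ, (p ⬝ᵥ b) * star (q ⬝ᵥ b) * (Real.exp (-∑ m, ‖b m‖ ^ 2) : ℝ) =
      (Real.pi : ℂ) ^ Fintype.card κ * (p ⬝ᵥ star q) := by
  classical
  have hI : ∀ k l : κ, Integrable fun b : κ → ℂ =>
      p k * star (q l) * ∏ m, gaussianFactor (m = k) (m = l) (b m) := fun k l =>
    (Integrable.fintype_prod_dep fun m => integrable_gaussianFactor _ _).const_mul _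
  simp only [dotProduct_mul_star_mul_gaussian_eq]
  rw [integral_finsetSum _ fun k _ => integrable_finsetSum _ fun l _ => hI k l, dotProduct,
    Finset.mul_sum]
  refine Finset.sum_congr rfl fun k _ => ?_
  rw [integral_finsetSum _ fun l _ => hI k l, Finset.sum_eq_single k]
  · rw [integral_const_mul, integral_fintype_prod_volume_eq_prod]
    simp only [integral_gaussianFactor, if_true, Finset.prod_const, Finset.card_univ, Pi.star_apply]
    ring
  · intro l _ hlk
    rw [integral_const_mul, integral_fintype_prod_volume_eq_prod,
      Finset.prod_eq_zero (Finset.mem_univ k), mul_zero]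
    rw [integral_gaussianFactor, if_neg]
    simpa using hlk.symm
  · simp

lemma dotProduct_star_self_eq_sum_norm_sq (u : κ → ℂ) :
    u ⬝ᵥ star u = ((∑ k, ‖u k‖ ^ 2 : ℝ) : ℂ) := by
  simp only [dotProduct, Pi.star_apply, Complex.star_def, Complex.mul_conj', Complex.ofReal_sum,
    Complex.ofReal_pow]

/-- A linear change of variables turning `‖c‖ ^ 2 + ‖u ⬝ᵥ c‖ ^ 2` into `‖b‖ ^ 2`. -/
lemma exists_linearMap_sum_norm_sq_add (u : κ → ℂ) :
    ∃ (T : (κ → ℂ) →ₗ[ℂ] (κ → ℂ)) (P : (κ → ℂ) → κ → ℂ),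
      Complex.normSq (LinearMap.det T) = (1 + ∑ k, ‖u k‖ ^ 2)⁻¹ ∧
      (∀ b, ∑ k, ‖T b k‖ ^ 2 + ‖u ⬝ᵥ T b‖ ^ 2 = ∑ k, ‖b k‖ ^ 2) ∧
      (∀ p b, p ⬝ᵥ T b = P p ⬝ᵥ b) ∧
      ∀ p q, P p ⬝ᵥ star (P q) = p ⬝ᵥ star q -
        ((1 + ∑ k, ‖u k‖ ^ 2)⁻¹ : ℝ) * ((p ⬝ᵥ star u) * (u ⬝ᵥ star q)) := by
  classical
  set s : ℝ := ∑ k, ‖u k‖ ^ 2 with hs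
  have hs0 : 0 ≤ s := Finset.sum_nonneg fun k _ => by positivity
  set δ : ℝ := (Real.sqrt (1 + s))⁻¹ with hδ
  have hδ0 : 0 < δ := by positivity
  have hδ2 : δ ^ 2 = (1 + s)⁻¹ := by rw [hδ, inv_pow, Real.sq_sqrt (by positivity)]
  set γ : ℝ := δ ^ 2 / (1 + δ) with hγ
  have h1 : γ * (1 + δ) = δ ^ 2 := by rw [hγ]; field_simp
  have h2 : 1 - γ * s = δ := by
    have : δ ^ 2 * (1 + s) = 1 := by rw [hδ2]; field_simp
    have h3 : (1 + δ) * (1 - γ * s - δ) = 0 := by linear_combination (-s) * h1 - this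
    have h4 : 1 + δ ≠ 0 := by positivity
    have := (mul_eq_zero.1 h3).resolve_left h4
    linarith
  have h1c : (γ : ℂ) * (1 + δ) = δ ^ 2 := by exact_mod_cast h1
  have h2c : 1 - (γ : ℂ) * s = δ := by exact_mod_cast h2
  have hus : u ⬝ᵥ star u = (s : ℂ) := dotProduct_star_self_eq_sum_norm_sq u
  have hP : ∀ p q : κ → ℂ, (p - (γ * (p ⬝ᵥ star u)) • u) ⬝ᵥ star (q - (γ * (q ⬝ᵥ star u)) • u) =
      p ⬝ᵥ star q - (δ ^ 2 : ℂ) * ((p ⬝ᵥ star u) * (u ⬝ᵥ star q)) := by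
    intro p q
    have e : star (q ⬝ᵥ star u) = u ⬝ᵥ star q := (dotProduct_star u q).symm
    have eγ : star (γ : ℂ) = γ := Complex.conj_ofReal γ
    simp only [star_sub, star_smul, star_mul', e, eγ, sub_dotProduct, dotProduct_sub,
      smul_dotProduct, dotProduct_smul, smul_eq_mul, hus]
    linear_combination (-(p ⬝ᵥ star u) * (u ⬝ᵥ star q) * γ) * h2c -
      ((p ⬝ᵥ star u) * (u ⬝ᵥ star q)) * h1c
  let f : Module.Dual ℂ (κ → ℂ) := dotProductBilin ℂ ℂ u
  have hf : ∀ b, f b = u ⬝ᵥ b := fun _ => rfl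
  have hT : ∀ b, LinearMap.transvection f ((-γ : ℂ) • star u) b =
      b - (γ * (u ⬝ᵥ b)) • star u := by
    intro b
    rw [LinearMap.transvection.apply, hf, smul_smul, sub_eq_add_neg, ← neg_smul]
    congr 2
    ring
  refine ⟨LinearMap.transvection f ((-γ : ℂ) • star u), fun p => p - (γ * (p ⬝ᵥ star u)) • u,
    ?_, ?_, ?_, ?_⟩
  · rw [LinearMap.transvection.det, map_smul, hf, hus, ← hδ2, smul_eq_mul, neg_mul,
      ← sub_eq_add_neg, h2c, Complex.normSq_ofReal, sq]
  · intro b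
    have e1 : ∀ b : κ → ℂ, ((∑ k, ‖b k‖ ^ 2 : ℝ) : ℂ) = b ⬝ᵥ star b := fun b =>
      (dotProduct_star_self_eq_sum_norm_sq b).symm
    have e2 : ∀ z : ℂ, ((‖z‖ ^ 2 : ℝ) : ℂ) = z * star z := fun z => by
      rw [Complex.star_def, Complex.mul_conj', Complex.ofReal_pow]
    have eγ : star (γ : ℂ) = γ := Complex.conj_ofReal γ
    rw [← Complex.ofReal_inj, Complex.ofReal_add, e1, e1, e2, hT]
    have e3 : star (u ⬝ᵥ b) = star u ⬝ᵥ star b := by rw [star_dotProduct_star, dotProduct_comm]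
    have es : star (s : ℂ) = s := Complex.conj_ofReal s
    have e4 : star u ⬝ᵥ u = s := by rw [dotProduct_comm, hus]
    have e5 : b ⬝ᵥ u = u ⬝ᵥ b := dotProduct_comm _ _
    simp only [star_sub, star_smul, star_mul', e3, eγ, sub_dotProduct, dotProduct_sub, star_star,
      smul_dotProduct, dotProduct_smul, smul_eq_mul, hus, e4, e5, es]
    linear_combination ((u ⬝ᵥ b) * (star u ⬝ᵥ star b) * (1 - γ * s + δ - γ)) * h2c -
      ((u ⬝ᵥ b) * (star u ⬝ᵥ star b)) * h1c
  · intro p b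
    rw [hT, dotProduct_sub, sub_dotProduct, dotProduct_smul, smul_dotProduct, smul_eq_mul,
      smul_eq_mul]
    ring
  · intro p q
    rw [hP, ← hδ2]
    push_cast
    rfl

lemma measurableEmbedding_map_volume_of_det_ne_zero (T : (κ → ℂ) →ₗ[ℂ] (κ → ℂ))
    (hT : LinearMap.det T ≠ 0) :
    MeasurableEmbedding T ∧ Measure.map T volume =
      ENNReal.ofReal (Complex.normSq (LinearMap.det T))⁻¹ • (volume : Measure (κ → ℂ)) := by
  classical
  constructor
  · let e := (LinearEquiv.ofIsUnitDet (f := T) (v := Pi.basisFun ℂ κ) (v' := Pi.basisFun ℂ κ)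
      (by rw [LinearMap.det_toMatrix]; exact hT.isUnit)).toContinuousLinearEquiv
    exact e.toHomeomorph.measurableEmbedding
  · have hd : LinearMap.det (T.restrictScalars ℝ) = Complex.normSq (LinearMap.det T) := by
      rw [← Algebra.norm_complex_apply, ← LinearMap.det_restrictScalars]
    have := Measure.map_linearMap_addHaar_eq_smul_addHaar (volume : Measure (κ → ℂ))
      (f := T.restrictScalars ℝ) (by rw [hd]; simpa using hT)
    rw [hd, abs_of_nonneg (inv_nonneg.2 (Complex.normSq_nonneg _))] at this
    exact this

/-- Second moments of the Gaussian with exponent `-‖c‖ ^ 2 - ‖u ⬝ᵥ c‖ ^ 2`. -/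
theorem integrable_and_integral_dotProduct_mul_star_gaussian (u p q : κ → ℂ) :
    Integrable (fun c : κ → ℂ => (p ⬝ᵥ c) * star (q ⬝ᵥ c) *
      (Real.exp (-(∑ m, ‖c m‖ ^ 2 + ‖u ⬝ᵥ c‖ ^ 2)) : ℝ)) ∧
    ∫ c : κ → ℂ, (p ⬝ᵥ c) * star (q ⬝ᵥ c) *
      (Real.exp (-(∑ m, ‖c m‖ ^ 2 + ‖u ⬝ᵥ c‖ ^ 2)) : ℝ) =
      (Real.pi : ℂ) ^ Fintype.card κ * (((1 + ∑ k, ‖u k‖ ^ 2)⁻¹ : ℝ) *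
        (p ⬝ᵥ star q - ((1 + ∑ k, ‖u k‖ ^ 2)⁻¹ : ℝ) * ((p ⬝ᵥ star u) * (u ⬝ᵥ star q)))) := by
  obtain ⟨T, P, hdet, hT, hP, hPP⟩ := exists_linearMap_sum_norm_sq_add u
  set F : (κ → ℂ) → ℂ := fun c => (p ⬝ᵥ c) * star (q ⬝ᵥ c) *
      (Real.exp (-(∑ m, ‖c m‖ ^ 2 + ‖u ⬝ᵥ c‖ ^ 2)) : ℝ) with hF
  set d : ℝ := (1 + ∑ k, ‖u k‖ ^ 2)⁻¹ with hd
  have hd0 : 0 < d := by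
    have : 0 ≤ ∑ k, ‖u k‖ ^ 2 := Finset.sum_nonneg fun k _ => by positivity
    positivity
  have hdet0 : LinearMap.det T ≠ 0 := by
    rw [← Complex.normSq_pos, hdet]
    exact hd0
  obtain ⟨hemb, hmap⟩ := measurableEmbedding_map_volume_of_det_ne_zero T hdet0
  rw [hdet] at hmap
  have hFT : ∀ b, F (T b) =
      (P p ⬝ᵥ b) * star (P q ⬝ᵥ b) * (Real.exp (-∑ m, ‖b m‖ ^ 2) : ℝ) := fun b => by
    rw [hF, ← hT b, ← hP p, ← hP q]
  have hne : ENNReal.ofReal d⁻¹ ≠ 0 := by simpa using hd0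
  constructor
  · rw [← integrable_smul_measure hne ENNReal.ofReal_ne_top, ← hmap, hemb.integrable_map_iff]
    exact (integrable_dotProduct_mul_star_mul_gaussian (P p) (P q)).congr
      (.of_forall fun b => (hFT b).symm)
  · have h := hemb.integral_map (μ := volume) F
    rw [hmap, integral_smul_measure, ENNReal.toReal_ofReal (by positivity)] at h
    simp only [hFT] at h
    rw [integral_dotProduct_mul_star_mul_gaussian, hPP, Complex.real_smul,
      Complex.ofReal_inv, inv_mul_eq_iff_eq_mul₀ (by exact_mod_cast hd0.ne')] at h
    rw [h]
    ring

end GaussianMoments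

section AreaFormula

open MeasureTheory Set
open scoped ENNReal NNReal

/-- If a set is injectively covered by countably many disjoint pieces, counting the pieces whose
image contains `y` counts the preimages of `y`. -/
lemma tsum_indicator_image_eq_encard {α β : Type*} {R : Set α} {f : α → β} {t : ℕ → Set α}
    (hdisj : Pairwise (Function.onFun Disjoint t)) (hcov : R ⊆ ⋃ k, t k)
    (hinj : ∀ k, InjOn f (R ∩ t k)) (y : β) :
    ∑' k, (f '' (R ∩ t k)).indicator (fun _ => (1 : ℝ≥0∞)) y = (R ∩ f ⁻¹' {y}).encard := by
  choose! piece hpiece using fun x (hx : x ∈ R) => mem_iUnion.1 (hcov hx)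
  have himage : piece '' (R ∩ f ⁻¹' {y}) = {k | y ∈ f '' (R ∩ t k)} := by
    ext k
    constructor
    · rintro ⟨x, ⟨hx, hxy⟩, rfl⟩
      exact ⟨x, ⟨hx, hpiece x hx⟩, hxy⟩
    · rintro ⟨x, ⟨hx, hxk⟩, hxy⟩
      refine ⟨x, ⟨hx, hxy⟩, ?_⟩
      by_contra hne
      exact disjoint_left.1 (hdisj hne) (hpiece x hx) hxk
  have hinjOn : InjOn piece (R ∩ f ⁻¹' {y}) := by
    rintro x ⟨hx, hxy⟩ x' ⟨hx', hxy'⟩ h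
    exact hinj (piece x) ⟨hx, hpiece x hx⟩ ⟨hx', h ▸ hpiece x' hx'⟩ (hxy.trans hxy'.symm)
  rw [← hinjOn.encard_image, himage, ← ENNReal.tsum_set_one,
    tsum_subtype {k | y ∈ f '' (R ∩ t k)} fun _ => (1 : ℝ≥0∞)]
  refine tsum_congr fun k => ?_
  by_cases h : y ∈ f '' (R ∩ t k)
  · rw [indicator_of_mem h, indicator_of_mem (by exact h)]
  · rw [indicator_of_notMem h, indicator_of_notMem (by exact h)]

/-- The area formula for a map almost all of whose fibres have the same number of points. -/
theorem lintegral_abs_det_mul_comp_of_encard_fiber {E : Type*} [NormedAddCommGroup E]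
    [NormedSpace ℝ E] [FiniteDimensional ℝ E] [MeasurableSpace E] [BorelSpace E]
    (μ : Measure E) [μ.IsAddHaarMeasure] {s : Set E} {f : E → E} {f' : E → E →L[ℝ] E}
    (hs : MeasurableSet s) (hf' : ∀ x ∈ s, HasFDerivWithinAt f (f' x) s x)
    (hdet : Measurable fun x => (f' x).det) {N : ℕ}
    (hN : ∀ᵐ y ∂μ, (s ∩ f ⁻¹' {y}).encard = N) {ρ : E → ℝ≥0∞} (hρ : Measurable ρ) :
    ∫⁻ x in s, ENNReal.ofReal |(f' x).det| * ρ (f x) ∂μ = N * ∫⁻ y, ρ y ∂μ := by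
  have hZ : MeasurableSet {x | (f' x).det = 0} := hdet (measurableSet_singleton 0)
  set R := s \ {x | (f' x).det = 0} with hR
  have hRm : MeasurableSet R := hs.diff hZ
  have hfR : ∀ x ∈ R, HasFDerivWithinAt f (f' x) R x := fun x hx =>
    (hf' x hx.1).mono sdiff_subset
  have hcrit : μ (f '' (s ∩ {x | (f' x).det = 0})) = 0 :=
    addHaar_image_eq_zero_of_det_fderivWithin_eq_zero μ
      (fun x hx => (hf' x hx.1).mono inter_subset_left) fun x hx => hx.2
  have hleft : ∫⁻ x in s, ENNReal.ofReal |(f' x).det| * ρ (f x) ∂μ =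
      ∫⁻ x in R, ENNReal.ofReal |(f' x).det| * ρ (f x) ∂μ := by
    rw [← lintegral_inter_add_sdiff _ s hZ, setLIntegral_congr_fun (g := fun _ => 0)
      (hs.inter hZ) fun x hx => ?_, lintegral_zero, zero_add]
    have h0 : (f' x).det = 0 := hx.2
    simp [h0]
  classical
  let r : (E →L[ℝ] E) → ℝ≥0 := fun A =>
    if h : A.det ≠ 0 then
      if Subsingleton E then 1 else
        ‖((A.toContinuousLinearEquivOfDetNeZero h).symm : E →L[ℝ] E)‖₊⁻¹ / 2
    else 1
  have hr0 : ∀ A, r A ≠ 0 := by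
    intro A
    simp only [r]
    split_ifs with h hE
    · exact one_ne_zero
    · have := not_subsingleton_iff_nontrivial.1 hE
      exact div_ne_zero (inv_ne_zero (ContinuousLinearEquiv.nnnorm_symm_pos _).ne') two_ne_zero
    · exact one_ne_zero
  obtain ⟨t, A, hdisj, htm, hcov, happrox, hA⟩ :=
    exists_partition_approximatesLinearOn_of_hasFDerivWithinAt f R f' hfR r hr0
  have hinj : ∀ k, InjOn f (R ∩ t k) := by
    intro k
    rcases R.eq_empty_or_nonempty with hemp | hne
    · rw [hemp, empty_inter]
      exact injOn_empty f
    obtain ⟨y, hy, hAy⟩ := hA hne k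
    have hdetA : (A k).det ≠ 0 := hAy ▸ hy.2
    have happ := happrox k
    refine ApproximatesLinearOn.injOn (f' := (A k).toContinuousLinearEquivOfDetNeZero hdetA)
      happ ?_
    by_cases hE : Subsingleton E
    · exact .inl hE
    · right
      have := not_subsingleton_iff_nontrivial.1 hE
      simp only [r, dif_pos hdetA, if_neg hE]
      exact NNReal.half_lt_self
        (inv_ne_zero (ContinuousLinearEquiv.nnnorm_symm_pos _).ne')
  have hRU : R = ⋃ k, R ∩ t k := by rw [← inter_iUnion, inter_eq_left.2 hcov]
  have hpm : ∀ k, MeasurableSet (R ∩ t k) := fun k => hRm.inter (htm k)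
  have hfp : ∀ k, ∀ x ∈ R ∩ t k, HasFDerivWithinAt f (f' x) (R ∩ t k) x := fun k x hx =>
    (hfR x hx.1).mono inter_subset_left
  have him : ∀ k, MeasurableSet (f '' (R ∩ t k)) := fun k =>
    measurable_image_of_fderivWithin (hpm k) (hfp k) (hinj k)
  rw [hleft, hRU, lintegral_iUnion hpm fun i j hij =>
    (hdisj hij).mono inter_subset_right inter_subset_right]
  simp only [← lintegral_image_eq_lintegral_abs_det_fderiv_mul μ (hpm _) (hfp _) (hinj _) ρ,
    ← lintegral_indicator (him _)]
  rw [← lintegral_tsum fun k => (hρ.indicator (him k)).aemeasurable,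
    ← lintegral_const_mul _ hρ]
  refine lintegral_congr_ae ?_
  filter_upwards [hN, measure_eq_zero_iff_ae_notMem.1 hcrit] with y hy hyc
  have hfib : R ∩ f ⁻¹' {y} = s ∩ f ⁻¹' {y} := by
    ext x
    refine ⟨fun hx => ⟨hx.1.1, hx.2⟩, fun hx => ⟨⟨hx.1, fun h0 => hyc ?_⟩, hx.2⟩⟩
    exact ⟨x, ⟨hx.1, h0⟩, hx.2⟩
  have hcount := tsum_indicator_image_eq_encard hdisj hcov hinj y
  rw [hfib, hy] at hcount
  have hmul : ∀ k, (f '' (R ∩ t k)).indicator ρ y =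
      (f '' (R ∩ t k)).indicator (fun _ => (1 : ℝ≥0∞)) y * ρ y := fun k => by
    by_cases h : y ∈ f '' (R ∩ t k) <;> simp [h]
  simp only [hmul]
  rw [ENNReal.tsum_mul_right, hcount]
  simp

end AreaFormula

section PolynomialNullSets

open MeasureTheory Set

lemma finite_setOf_eval_add_smul_eq_zero {σ : Type*} (D : MvPolynomial σ ℂ) (a v : σ → ℂ)
    (h : MvPolynomial.eval a D ≠ 0) :
    {r : ℝ | MvPolynomial.eval (a + (r : ℂ) • v) D = 0}.Finite := by
  set P : Polynomial ℂ := MvPolynomial.aeval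
    (fun i => Polynomial.C (a i) + Polynomial.X * Polynomial.C (v i)) D with hP
  have heval : ∀ z : ℂ, P.eval z = MvPolynomial.eval (a + z • v) D := by
    intro z
    rw [hP, ← Polynomial.coe_evalRingHom, MvPolynomial.aeval_def, MvPolynomial.hom_eval₂,
      MvPolynomial.eval, MvPolynomial.coe_eval₂Hom]
    congr 1
    · ext w
      simp
    · ext i
      simp
      exact mul_comm _ _
  have hP0 : P ≠ 0 := by
    rintro h0
    apply h
    have := heval 0
    rw [h0, zero_smul, add_zero, Polynomial.eval_zero] at this
    exact this.symm
  refine Finite.subset ((Polynomial.finite_setOfPred_isRoot hP0).preimage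
    (Complex.ofReal_injective.injOn (s := _))) fun r hr => ?_
  exact (heval r).trans hr

/-- A nonzero polynomial composed with a surjective real linear map vanishes almost nowhere. -/
theorem ae_eval_linearMap_ne_zero {σ E : Type*} [Finite σ] [NormedAddCommGroup E]
    [NormedSpace ℝ E] [FiniteDimensional ℝ E] [MeasurableSpace E] [BorelSpace E] (μ : Measure E)
    [μ.IsAddHaarMeasure] (L : E →ₗ[ℝ] (σ → ℂ)) (hL : Function.Surjective L)
    {D : MvPolynomial σ ℂ} (hD : D ≠ 0) : ∀ᵐ x ∂μ, MvPolynomial.eval (L x) D ≠ 0 := by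
  have := Fintype.ofFinite σ
  obtain ⟨a, ha⟩ : ∃ a, MvPolynomial.eval a D ≠ 0 := by
    by_contra! h
    exact hD (MvPolynomial.funext fun x => by simpa using h x)
  obtain ⟨x₀, rfl⟩ := hL a
  set Z : Set E := {y | MvPolynomial.eval (L (x₀ + y)) D = 0} with hZ
  have hZc : IsClosed Z := by
    refine isClosed_singleton.preimage (f := fun y => MvPolynomial.eval (L (x₀ + y)) D) ?_
    exact (MvPolynomial.continuous_eval D).comp
      (L.continuous_of_finiteDimensional.comp (continuous_const.add continuous_id))
  suffices hμ : μ Z = 0 by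
    rw [ae_iff]
    have : {x | ¬MvPolynomial.eval (L x) D ≠ 0} = (fun x => -x₀ + x) ⁻¹' Z := by
      ext x
      simp [hZ]
    rw [this, measure_preimage_add, hμ]
  set W : Set (ℝ × E) := (fun q : ℝ × E => q.1 • q.2) ⁻¹' Z with hW
  have hWm : MeasurableSet W := (hZc.preimage continuous_smul).measurableSet
  have hWnull : (volume.prod μ) W = 0 := by
    rw [Measure.prod_apply_symm hWm, lintegral_eq_zero_iff (measurable_measure_prodMk_right hWm)]
    refine .of_forall fun y => ?_
    refine ((finite_setOf_eval_add_smul_eq_zero D (L x₀) (L y) ha).subset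
      fun r hr => ?_).measure_zero _
    have hr' : MvPolynomial.eval (L (x₀ + r • y)) D = 0 := hr
    rwa [map_add, map_smul, ← Complex.coe_smul] at hr'
  have h1 : ∀ᵐ r : ℝ, μ (Prod.mk r ⁻¹' W) = 0 := (Measure.measure_prod_null hWm).1 hWnull
  obtain ⟨r, hr, hr0⟩ : ∃ r : ℝ, μ (Prod.mk r ⁻¹' W) = 0 ∧ r ≠ 0 := by
    have h2 : ∀ᵐ r : ℝ, r ≠ 0 := by simp [ae_iff]
    exact (h1.and h2).exists
  have h3 : Prod.mk r ⁻¹' W = (r • ·) ⁻¹' Z := rfl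
  rw [h3, Measure.addHaar_preimage_smul μ hr0, mul_eq_zero] at hr
  refine hr.resolve_left ?_
  have := abs_pos.2 hr0
  simp only [abs_inv, abs_pow, ENNReal.ofReal_eq_zero, not_le]
  positivity

end PolynomialNullSets

section MixedDiscriminant

open Equiv

lemma sum_neg_one_pow_prod_sum_eq_sum_perm {ι R : Type*} [Fintype ι] [DecidableEq ι] [CommRing R]
    (a : ι → ι → R) :
    ∑ S : Finset ι, (-1 : R) ^ (Fintype.card ι - S.card) * ∏ r, ∑ i ∈ S, a r i =
      ∑ ρ : Perm ι, ∏ r, a r (ρ r) := by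
  have h1 : ∀ U : Finset ι, (-1 : R) ^ (Fintype.card ι - Uᶜ.card) * ∏ r, ∑ i ∈ Uᶜ, a r i =
      ∑ f : ι → ι, if U ∈ (Finset.univ.image f)ᶜ.powerset then (-1) ^ U.card * ∏ r, a r (f r)
        else 0 := by
    intro U
    rw [Finset.card_compl, Nat.sub_sub_self (Finset.card_le_univ U), Finset.prod_univ_sum,
      Finset.mul_sum, ← Finset.sum_filter]
    refine Finset.sum_congr ?_ fun _ _ => rfl
    ext f
    simp only [Fintype.mem_piFinset, Finset.mem_compl, Finset.mem_filter, Finset.mem_univ,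
      true_and, Finset.mem_powerset, Finset.subset_iff, Finset.mem_image, not_exists]
    exact ⟨fun h x hx r hr => h r (hr ▸ hx), fun h r hr => h hr r rfl⟩
  rw [← (Function.Involutive.bijective compl_compl :
    Function.Bijective (compl : Finset ι → Finset ι)).sum_comp,
    Finset.sum_congr rfl fun U _ => h1 U,
    Finset.sum_comm]
  have h2 : ∀ f : ι → ι, (∑ U : Finset ι, if U ∈ (Finset.univ.image f)ᶜ.powerset then
      (-1) ^ U.card * ∏ r, a r (f r) else 0) =
      if Function.Bijective f then ∏ r, a r (f r) else 0 := by
    intro f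
    rw [← Finset.sum_filter, Finset.filter_mem_eq_inter, Finset.univ_inter, ← Finset.sum_mul]
    have := congrArg (Int.cast : ℤ → R)
      (Finset.sum_powerset_neg_one_pow_card (x := (Finset.univ.image f)ᶜ))
    push_cast at this
    rw [this]
    have hiff : (Finset.univ.image f)ᶜ = ∅ ↔ Function.Bijective f := by
      rw [Finset.compl_eq_empty_iff, ← Finite.surjective_iff_bijective, Finset.eq_univ_iff_forall]
      simp [Function.Surjective]
    simp only [hiff, ite_mul, one_mul, zero_mul]
  rw [Finset.sum_congr rfl fun f _ => h2 f, ← Finset.sum_filter]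
  symm
  refine Finset.sum_bij (fun ρ _ => ⇑ρ) (fun ρ _ => by simp)
    (fun ρ _ σ _ h => DFunLike.coe_injective h) (fun f hf => ?_) fun _ _ => rfl
  exact ⟨Equiv.ofBijective f (Finset.mem_filter.1 hf).2, Finset.mem_univ _, rfl⟩

/-- The polarized determinant as an alternating sum of determinants of partial sums. -/
theorem sum_perm_perm_eq_sum_neg_one_pow_det {ι R : Type*} [Fintype ι] [DecidableEq ι]
    [CommRing R] (C : ι → Matrix ι ι R) :
    ∑ σ : Perm ι, ∑ τ : Perm ι,
        ((Perm.sign σ : ℤ) : R) * ((Perm.sign τ : ℤ) : R) * ∏ i, C i (σ i) (τ i) =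
      ∑ S : Finset ι, (-1 : R) ^ (Fintype.card ι - S.card) * (∑ i ∈ S, C i).det := by
  have h : ∀ S : Finset ι, (-1 : R) ^ (Fintype.card ι - S.card) * (∑ i ∈ S, C i).det =
      ∑ τ : Perm ι, ((Perm.sign τ : ℤ) : R) *
        ((-1 : R) ^ (Fintype.card ι - S.card) * ∏ r, ∑ i ∈ S, C i (τ r) r) := by
    intro S
    rw [Matrix.det_apply', Finset.mul_sum]
    refine Finset.sum_congr rfl fun τ _ => ?_
    simp only [Matrix.sum_apply]
    ring
  symm
  rw [Finset.sum_congr rfl fun S _ => h S, Finset.sum_comm]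
  have h3 : ∀ τ : Perm ι, (∑ S : Finset ι, ((Perm.sign τ : ℤ) : R) *
      ((-1 : R) ^ (Fintype.card ι - S.card) * ∏ r, ∑ i ∈ S, C i (τ r) r)) =
      ∑ ρ : Perm ι, ((Perm.sign τ : ℤ) : R) * ∏ r, C (ρ r) (τ r) r := by
    intro τ
    rw [← Finset.mul_sum, sum_neg_one_pow_prod_sum_eq_sum_perm fun r i => C i (τ r) r,
      Finset.mul_sum]
  rw [Finset.sum_congr rfl fun τ _ => h3 τ, Finset.sum_comm]
  have h4 : ∀ ρ : Perm ι, (∑ τ : Perm ι, ((Perm.sign τ : ℤ) : R) * ∏ r, C (ρ r) (τ r) r) =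
      ∑ σ : Perm ι, ((Perm.sign σ : ℤ) : R) * ((Perm.sign ρ⁻¹ : ℤ) : R) *
        ∏ i, C i (σ i) (ρ⁻¹ i) := by
    intro ρ
    rw [← Equiv.sum_comp (Equiv.mulRight ρ)]
    refine Finset.sum_congr rfl fun σ _ => ?_
    rw [Equiv.coe_mulRight, Perm.sign_mul, Perm.sign_inv,
      ← Equiv.prod_comp ρ fun i => C i (σ i) (ρ⁻¹ i)]
    simp
  rw [Finset.sum_congr rfl fun ρ _ => h4 ρ, Finset.sum_comm]
  exact Finset.sum_congr rfl fun σ _ => Equiv.sum_comp (Equiv.inv (Perm ι)) fun τ =>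
    ((Perm.sign σ : ℤ) : R) * ((Perm.sign τ : ℤ) : R) * ∏ i, C i (σ i) (τ i)

end MixedDiscriminant

section GibbsMoments

open Matrix

variable {n : ℕ}

/-- The coordinatewise exponential, with values in the torus. -/
noncomputable def torusExp (z : Fin n → ℂ) : Fin n → ℂˣ :=
  fun j => Units.mk0 (Complex.exp (z j)) (Complex.exp_ne_zero _)

lemma laurentMonomial_torusExp (z : Fin n → ℂ) (m : Fin n → ℤ) :
    laurentMonomial (torusExp z) m = Complex.exp (∑ j, m j * z j) := by
  simp only [laurentMonomial, torusExp, Units.coe_prod, Units.val_zpow_eq_zpow_val, Units.val_mk0,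
    Complex.exp_sum, Complex.exp_int_mul]

/-- Adjoin the origin to a family of lattice points. -/
def consOrigin {κ : Type*} (q : κ → Fin n → ℤ) : Option κ → Fin n → ℝ :=
  fun o => o.elim 0 fun k j => q k j

variable {κ : Type*} [Fintype κ]

lemma norm_sq_laurentMonomial_torusExp (z : Fin n → ℂ) (m : Fin n → ℤ) :
    ‖laurentMonomial (torusExp z) m‖ ^ 2 =
      Real.exp (2 * ((fun j => (m j : ℝ)) ⬝ᵥ fun j => (z j).re)) := by
  rw [laurentMonomial_torusExp, Complex.norm_exp, ← Real.exp_nat_mul]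
  congr 2
  simp [dotProduct]

lemma gibbsCov_consOrigin (q : κ → Fin n → ℤ) (z : Fin n → ℂ) (j l : Fin n) :
    (gibbsCov (consOrigin q) (fun j => (z j).re) j l : ℂ) =
      ((1 + ∑ k, ‖laurentMonomial (torusExp z) (q k)‖ ^ 2)⁻¹ : ℝ) *
        (((fun k => q k j * laurentMonomial (torusExp z) (q k)) ⬝ᵥ
            star fun k => q k l * laurentMonomial (torusExp z) (q k)) -
          ((1 + ∑ k, ‖laurentMonomial (torusExp z) (q k)‖ ^ 2)⁻¹ : ℝ) *
          (((fun k => q k j * laurentMonomial (torusExp z) (q k)) ⬝ᵥ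
              star fun k => laurentMonomial (torusExp z) (q k)) *
            ((fun k => laurentMonomial (torusExp z) (q k)) ⬝ᵥ
              star fun k => q k l * laurentMonomial (torusExp z) (q k)))) := by
  set u : κ → ℂ := fun k => laurentMonomial (torusExp z) (q k) with hu
  set x : Fin n → ℝ := fun j => (z j).re with hx
  have hsum : gibbsSum (consOrigin q) x = 1 + ∑ k, ‖u k‖ ^ 2 := by
    simp [gibbsSum, Fintype.sum_option, consOrigin, hu, norm_sq_laurentMonomial_torusExp, hx]
  have hgibbs : ∀ k, gibbs (consOrigin q) x (some k) =
      (1 + ∑ k, ‖u k‖ ^ 2)⁻¹ * ‖u k‖ ^ 2 := by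
    intro k
    rw [gibbs, hsum, hu, norm_sq_laurentMonomial_torusExp, div_eq_inv_mul]
    rfl
  set d : ℝ := (1 + ∑ k, ‖u k‖ ^ 2)⁻¹
  have hmul : ∀ k, u k * star (u k) = (‖u k‖ : ℂ) ^ 2 := fun k => by
    rw [Complex.star_def, Complex.mul_conj']
  have hstar : ∀ m : ℤ, star (m : ℂ) = m := fun m => by simp
  have e1 : ((fun k => q k j * u k) ⬝ᵥ star fun k => q k l * u k) =
      ((∑ k, q k j * q k l * ‖u k‖ ^ 2 : ℝ) : ℂ) := by
    rw [dotProduct, Complex.ofReal_sum]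
    refine Finset.sum_congr rfl fun k _ => ?_
    simp only [Pi.star_apply, star_mul', hstar]
    push_cast
    linear_combination ((q k j : ℂ) * q k l) * hmul k
  have e2 : ((fun k => q k j * u k) ⬝ᵥ star fun k => u k) =
      ((∑ k, q k j * ‖u k‖ ^ 2 : ℝ) : ℂ) := by
    rw [dotProduct, Complex.ofReal_sum]
    refine Finset.sum_congr rfl fun k _ => ?_
    simp only [Pi.star_apply]
    push_cast
    linear_combination (q k j : ℂ) * hmul k
  have e3 : ((fun k => u k) ⬝ᵥ star fun k => q k l * u k) =
      ((∑ k, q k l * ‖u k‖ ^ 2 : ℝ) : ℂ) := by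
    rw [dotProduct, Complex.ofReal_sum]
    refine Finset.sum_congr rfl fun k _ => ?_
    simp only [Pi.star_apply, star_mul', hstar]
    push_cast
    linear_combination (q k l : ℂ) * hmul k
  have hu' : u = fun k => u k := rfl
  rw [hu', e1, e2, e3]
  simp only [← Complex.ofReal_mul, ← Complex.ofReal_sub, Complex.ofReal_inj]
  simp only [gibbsCov, gibbsMean, of_apply, Fintype.sum_option, hgibbs]
  simp only [consOrigin, Option.elim, Pi.zero_apply, mul_zero, zero_add, mul_assoc,
    ← Finset.mul_sum]
  have c1 : ∀ k, ‖u k‖ ^ 2 * ((q k j : ℝ) * q k l) = q k j * (q k l * ‖u k‖ ^ 2) := fun k => by ring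
  have c2 : ∀ k j, ‖u k‖ ^ 2 * (q k j : ℝ) = q k j * ‖u k‖ ^ 2 := fun k j => by ring
  simp only [c1, c2]
  ring

end GibbsMoments

section GaussianJacobian

open Matrix MeasureTheory

variable {n : ℕ} {κ : Fin n → Type} [∀ i, Fintype (κ i)]

/-- The squared logarithmic Jacobian weighted by the Gaussian densities of all coefficients, the
constant terms being determined by the condition that `torusExp z` is a root. -/
noncomputable def jacobianGaussian (q : ∀ i, κ i → Fin n → ℤ) (z : Fin n → ℂ)
    (c : ∀ i, κ i → ℂ) : ℝ :=
  Complex.normSq (logJacobian q c (torusExp z)).det *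
    Real.exp (-∑ i, (∑ k, ‖c i k‖ ^ 2 +
      ‖(fun k => laurentMonomial (torusExp z) (q i k)) ⬝ᵥ c i‖ ^ 2))

lemma det_eq_sum_perm_prod {ι R : Type*} [Fintype ι] [DecidableEq ι] [CommRing R]
    (M : Matrix ι ι R) :
    M.det = ∑ σ : Equiv.Perm ι, ((Equiv.Perm.sign σ : ℤ) : R) * ∏ i, M i (σ i) := by
  rw [← det_transpose, det_apply']
  rfl

lemma jacobianGaussian_eq_sum (q : ∀ i, κ i → Fin n → ℤ) (z : Fin n → ℂ) (c : ∀ i, κ i → ℂ) :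
    (jacobianGaussian q z c : ℂ) = ∑ σ : Equiv.Perm (Fin n), ∑ τ : Equiv.Perm (Fin n),
      ((Equiv.Perm.sign σ : ℤ) : ℂ) * ((Equiv.Perm.sign τ : ℤ) : ℂ) * ∏ i,
        (((fun k => q i k (σ i) * laurentMonomial (torusExp z) (q i k)) ⬝ᵥ c i) *
          star ((fun k => q i k (τ i) * laurentMonomial (torusExp z) (q i k)) ⬝ᵥ c i) *
          (Real.exp (-(∑ k, ‖c i k‖ ^ 2 +
            ‖(fun k => laurentMonomial (torusExp z) (q i k)) ⬝ᵥ c i‖ ^ 2)) : ℝ)) := by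
  have hJ : ∀ i j, logJacobian q c (torusExp z) i j =
      (fun k => q i k j * laurentMonomial (torusExp z) (q i k)) ⬝ᵥ c i := by
    intro i j
    simp only [logJacobian, of_apply, dotProduct]
    exact Finset.sum_congr rfl fun k _ => by ring
  rw [jacobianGaussian, Complex.ofReal_mul, ← Complex.mul_conj, ← Complex.star_def,
    det_eq_sum_perm_prod, star_sum, Finset.sum_mul_sum, Finset.sum_mul]
  refine Finset.sum_congr rfl fun σ _ => ?_
  rw [Finset.sum_mul]
  refine Finset.sum_congr rfl fun τ _ => ?_
  have hs : star (((Equiv.Perm.sign τ : ℤ) : ℂ)) = ((Equiv.Perm.sign τ : ℤ) : ℂ) := by simp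
  rw [star_mul', hs, star_prod, ← Finset.sum_neg_distrib, Real.exp_sum, Complex.ofReal_prod]
  simp only [hJ, Finset.prod_mul_distrib]
  ring

theorem integrable_and_integral_jacobianGaussian (q : ∀ i, κ i → Fin n → ℤ) (z : Fin n → ℂ) :
    Integrable (jacobianGaussian q z) ∧
    ∫ c, jacobianGaussian q z c = Real.pi ^ (∑ i, Fintype.card (κ i)) *
      ∑ S : Finset (Fin n), (-1 : ℝ) ^ (n - S.card) *
        (∑ i ∈ S, gibbsCov (consOrigin (q i)) fun j => (z j).re).det := by
  have hintegrable : ∀ σ τ : Equiv.Perm (Fin n), Integrable fun c : ∀ i, κ i → ℂ =>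
      ((Equiv.Perm.sign σ : ℤ) : ℂ) * ((Equiv.Perm.sign τ : ℤ) : ℂ) * ∏ i,
        (((fun k => q i k (σ i) * laurentMonomial (torusExp z) (q i k)) ⬝ᵥ c i) *
          star ((fun k => q i k (τ i) * laurentMonomial (torusExp z) (q i k)) ⬝ᵥ c i) *
          (Real.exp (-(∑ k, ‖c i k‖ ^ 2 +
            ‖(fun k => laurentMonomial (torusExp z) (q i k)) ⬝ᵥ c i‖ ^ 2)) : ℝ)) := fun σ τ =>
    (Integrable.fintype_prod_dep fun i =>
      (integrable_and_integral_dotProduct_mul_star_gaussian _ _ _).1).const_mul _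
  have hintC : Integrable fun c => (jacobianGaussian q z c : ℂ) := by
    simp only [jacobianGaussian_eq_sum]
    exact integrable_finsetSum _ fun σ _ => integrable_finsetSum _ fun τ _ => hintegrable σ τ
  refine ⟨by simpa using hintC.re, ?_⟩
  rw [← Complex.ofReal_inj, ← integral_complex_ofReal]
  simp only [jacobianGaussian_eq_sum]
  rw [integral_finsetSum _ fun σ _ => integrable_finsetSum _ fun τ _ => hintegrable σ τ]
  have hστ : ∀ σ τ : Equiv.Perm (Fin n), ∫ c : ∀ i, κ i → ℂ,
      ((Equiv.Perm.sign σ : ℤ) : ℂ) * ((Equiv.Perm.sign τ : ℤ) : ℂ) * ∏ i,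
        (((fun k => q i k (σ i) * laurentMonomial (torusExp z) (q i k)) ⬝ᵥ c i) *
          star ((fun k => q i k (τ i) * laurentMonomial (torusExp z) (q i k)) ⬝ᵥ c i) *
          (Real.exp (-(∑ k, ‖c i k‖ ^ 2 +
            ‖(fun k => laurentMonomial (torusExp z) (q i k)) ⬝ᵥ c i‖ ^ 2)) : ℝ)) =
      (Real.pi : ℂ) ^ (∑ i, Fintype.card (κ i)) *
        ((((Equiv.Perm.sign σ : ℤ) : ℝ) * ((Equiv.Perm.sign τ : ℤ) : ℝ) *
          ∏ i, gibbsCov (consOrigin (q i)) (fun j => (z j).re) (σ i) (τ i) : ℝ) : ℂ) := by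
    intro σ τ
    rw [integral_const_mul, integral_fintype_prod_volume_eq_prod (fun i (c : κ i → ℂ) =>
      (((fun k => q i k (σ i) * laurentMonomial (torusExp z) (q i k)) ⬝ᵥ c) *
          star ((fun k => q i k (τ i) * laurentMonomial (torusExp z) (q i k)) ⬝ᵥ c) *
          (Real.exp (-(∑ k, ‖c k‖ ^ 2 +
            ‖(fun k => laurentMonomial (torusExp z) (q i k)) ⬝ᵥ c‖ ^ 2)) : ℝ)))]
    simp only [(integrable_and_integral_dotProduct_mul_star_gaussian _ _ _).2,
      ← gibbsCov_consOrigin, Finset.prod_mul_distrib, Finset.prod_pow_eq_pow_sum]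
    push_cast
    ring
  have hdet := sum_perm_perm_eq_sum_neg_one_pow_det fun i =>
    gibbsCov (consOrigin (q i)) fun j => (z j).re
  rw [Fintype.card_fin] at hdet
  rw [← hdet, Complex.ofReal_mul, Complex.ofReal_pow, Complex.ofReal_sum, Finset.mul_sum]
  refine Finset.sum_congr rfl fun σ _ => ?_
  rw [integral_finsetSum _ fun τ _ => hintegrable σ τ, Complex.ofReal_sum, Finset.mul_sum]
  exact Finset.sum_congr rfl fun τ _ => hστ σ τ

end GaussianJacobian

section FiberCount

open Matrix MeasureTheory Set
open scoped ENNReal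

variable {n : ℕ} {κ : Fin n → Type} [∀ i, Fintype (κ i)]

/-- The fundamental domain of `torusExp`. -/
def torusStrip (n : ℕ) : Set (Fin n → ℂ) := {z | ∀ j, (z j).im ∈ Ioc (-Real.pi) Real.pi}

/-- The constant terms for which `torusExp z` is a root. -/
noncomputable def sparseMap (q : ∀ i, κ i → Fin n → ℤ) (c : ∀ i, κ i → ℂ) (z : Fin n → ℂ) :
    Fin n → ℂ :=
  fun i => -∑ k, c i k * laurentMonomial (torusExp z) (q i k)

lemma bijOn_torusExp (q : ∀ i, κ i → Fin n → ℤ) (c : ∀ i, κ i → ℂ) (b : Fin n → ℂ) :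
    BijOn torusExp (torusStrip n ∩ sparseMap q c ⁻¹' {b}) (sparseRoots q c b) := by
  refine ⟨?_, ?_, ?_⟩
  · rintro z ⟨-, hz⟩ i
    rw [← show sparseMap q c z = b from hz]
    exact neg_add_cancel _
  · rintro z ⟨hz, -⟩ z' ⟨hz', -⟩ h
    ext1 j
    have hj : Complex.exp (z j) = Complex.exp (z' j) := congrArg Units.val (congrFun h j)
    rw [← Complex.log_exp (hz j).1 (hz j).2, hj, Complex.log_exp (hz' j).1 (hz' j).2]
  · intro t ht
    have hexp : torusExp (fun j => Complex.log (t j : ℂ)) = t := by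
      ext j
      exact Complex.exp_log (t j).ne_zero
    refine ⟨fun j => Complex.log (t j : ℂ), ⟨fun j => ?_, ?_⟩, hexp⟩
    · rw [Complex.log_im]
      exact Complex.arg_mem_Ioc _
    · change sparseMap q c _ = b
      ext i
      simp only [sparseMap, hexp]
      exact neg_eq_of_add_eq_zero_left (ht i)

lemma continuous_laurentMonomial_torusExp (m : Fin n → ℤ) :
    Continuous fun z : Fin n → ℂ => laurentMonomial (torusExp z) m := by
  simp only [laurentMonomial_torusExp]
  fun_prop

lemma hasFDerivAt_laurentMonomial_torusExp (m : Fin n → ℤ) (z : Fin n → ℂ) :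
    HasFDerivAt (fun z : Fin n → ℂ => laurentMonomial (torusExp z) m)
      (laurentMonomial (torusExp z) m •
        ∑ j, (m j : ℂ) • ContinuousLinearMap.proj (R := ℂ) (φ := fun _ : Fin n => ℂ) j) z := by
  simp only [laurentMonomial_torusExp]
  refine HasFDerivAt.cexp ?_
  exact HasFDerivAt.fun_sum fun j _ => (hasFDerivAt_apply j z).const_mul (m j : ℂ)

/-- The derivative of `sparseMap`. -/
noncomputable def sparseMapDeriv (q : ∀ i, κ i → Fin n → ℤ) (c : ∀ i, κ i → ℂ)
    (z : Fin n → ℂ) : (Fin n → ℂ) →L[ℝ] (Fin n → ℂ) :=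
  ContinuousLinearMap.restrictScalars ℝ
    (LinearMap.toContinuousLinearMap (toLin' (-logJacobian q c (torusExp z))))

lemma hasFDerivAt_sparseMap (q : ∀ i, κ i → Fin n → ℤ) (c : ∀ i, κ i → ℂ) (z : Fin n → ℂ) :
    HasFDerivAt (sparseMap q c) (sparseMapDeriv q c z) z := by
  refine HasFDerivAt.restrictScalars ℝ ?_
  rw [hasFDerivAt_pi']
  intro i
  refine HasFDerivAt.congr_fderiv (HasFDerivAt.fun_sum fun k _ =>
    (hasFDerivAt_laurentMonomial_torusExp (q i k) z).const_mul (c i k)).neg ?_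
  refine ContinuousLinearMap.ext fun v => ?_
  simp only [ContinuousLinearMap.comp_apply, ContinuousLinearMap.proj_apply,
    LinearMap.coe_toContinuousLinearMap', toLin'_apply, mulVec, dotProduct, _root_.neg_apply,
    Matrix.neg_apply, _root_.sum_apply, _root_.smul_apply, smul_eq_mul, logJacobian, of_apply,
    Finset.sum_mul, Finset.mul_sum,
    neg_mul, Finset.sum_neg_distrib]
  rw [Finset.sum_comm]
  congr 1
  exact Finset.sum_congr rfl fun j _ => Finset.sum_congr rfl fun k _ => by ring

lemma det_sparseMapDeriv (q : ∀ i, κ i → Fin n → ℤ) (c : ∀ i, κ i → ℂ) (z : Fin n → ℂ) :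
    (sparseMapDeriv q c z).det = Complex.normSq (logJacobian q c (torusExp z)).det := by
  have h : (sparseMapDeriv q c z).det =
      LinearMap.det ((toLin' (-logJacobian q c (torusExp z))).restrictScalars ℝ) := rfl
  rw [h, LinearMap.det_restrictScalars, Algebra.norm_complex_apply, LinearMap.det_toLin', det_neg,
    map_mul, map_pow, Complex.normSq_neg, map_one, one_pow, one_mul]

lemma continuous_det_logJacobian_torusExp (q : ∀ i, κ i → Fin n → ℤ) :
    Continuous fun p : (∀ i, κ i → ℂ) × (Fin n → ℂ) =>
      (logJacobian q p.1 (torusExp p.2)).det := by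
  refine Continuous.matrix_det (continuous_matrix fun i j => ?_)
  simp only [logJacobian, of_apply]
  have h := fun k => (continuous_laurentMonomial_torusExp (q i k)).comp
    (continuous_snd (X := ∀ i, κ i → ℂ))
  simp only [Function.comp_def] at h
  fun_prop

lemma measurableSet_torusStrip (n : ℕ) : MeasurableSet (torusStrip n) := by
  have : torusStrip n = ⋂ j, (fun z : Fin n → ℂ => (z j).im) ⁻¹' Ioc (-Real.pi) Real.pi := by
    ext z
    simp [torusStrip]
  rw [this]
  exact .iInter fun j => measurableSet_Ioc.preimage (by fun_prop)

lemma lintegral_gaussian_eq_pi_pow (κ : Type*) [Fintype κ] :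
    ∫⁻ b : κ → ℂ, ENNReal.ofReal (Real.exp (-∑ m, ‖b m‖ ^ 2)) =
      ENNReal.ofReal (Real.pi ^ Fintype.card κ) := by
  have hI : ∫ z : ℂ, Real.exp (-‖z‖ ^ 2) = Real.pi := by
    have := integral_exp_neg_sq_complex
    rwa [integral_complex_ofReal, Complex.ofReal_inj] at this
  have hintegrable : Integrable fun z : ℂ => Real.exp (-‖z‖ ^ 2) :=
    .of_integral_ne_zero (by rw [hI]; exact Real.pi_ne_zero)
  have hprod : ∀ b : κ → ℂ, Real.exp (-∑ m, ‖b m‖ ^ 2) = ∏ m, Real.exp (-‖b m‖ ^ 2) := fun b => by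
    rw [← Finset.sum_neg_distrib, Real.exp_sum]
  rw [← ofReal_integral_eq_lintegral_ofReal _ (.of_forall fun b => (Real.exp_pos _).le)]
  · simp only [hprod]
    rw [integral_fintype_prod_volume_eq_prod fun _ (z : ℂ) => Real.exp (-‖z‖ ^ 2), hI,
      Finset.prod_const, Finset.card_univ]
  · simp only [hprod]
    exact Integrable.fintype_prod_dep fun _ => hintegrable

/-- The expected weight of the roots, for coefficients `c` admitting `N` roots generically. -/
theorem lintegral_jacobianGaussian_torusStrip (q : ∀ i, κ i → Fin n → ℤ) (c : ∀ i, κ i → ℂ)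
    {N : ℕ} (hN : ∀ᵐ b, (sparseRoots q c b).encard = N) :
    ∫⁻ z in torusStrip n, ENNReal.ofReal (jacobianGaussian q z c) =
      N * ENNReal.ofReal (Real.pi ^ n) *
        ENNReal.ofReal (Real.exp (-∑ i, ∑ k, ‖c i k‖ ^ 2)) := by
  have hρ : Measurable fun b : Fin n → ℂ => ENNReal.ofReal (Real.exp (-∑ i, ‖b i‖ ^ 2)) := by
    fun_prop
  have hmain := lintegral_abs_det_mul_comp_of_encard_fiber volume (measurableSet_torusStrip n)
    (fun z _ => (hasFDerivAt_sparseMap q c z).hasFDerivWithinAt) (N := N) ?_ ?_ hρ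
  rotate_left
  · simp only [det_sparseMapDeriv]
    exact ((Complex.continuous_normSq.comp
      (continuous_det_logJacobian_torusExp q)).comp (Continuous.prodMk_right c)).measurable
  · filter_upwards [hN] with b hb
    have h := bijOn_torusExp q c b
    rw [← hb, ← h.image_eq, h.injOn.encard_image]
  rw [lintegral_gaussian_eq_pi_pow, Fintype.card_fin] at hmain
  rw [← hmain, ← lintegral_mul_const]
  · refine lintegral_congr fun z => ?_
    rw [det_sparseMapDeriv, abs_of_nonneg (Complex.normSq_nonneg _),
      ← ENNReal.ofReal_mul (Complex.normSq_nonneg _), ← ENNReal.ofReal_mul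
        (mul_nonneg (Complex.normSq_nonneg _) (Real.exp_pos _).le), jacobianGaussian, mul_assoc,
      ← Real.exp_add, Finset.sum_add_distrib, neg_add, add_comm]
    simp only [sparseMap, norm_neg, dotProduct, mul_comm]
  · simp only [det_sparseMapDeriv]
    have hdet := ((Complex.continuous_normSq.comp
      (continuous_det_logJacobian_torusExp q)).comp (Continuous.prodMk_right c)).measurable
    have hsparse : Measurable (sparseMap q c) := by
      refine measurable_pi_lambda _ fun i => Measurable.neg ?_
      exact Finset.measurable_fun_sum _ fun k _ =>
        (continuous_laurentMonomial_torusExp (q i k)).measurable.const_mul _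
    exact ((hdet.abs).ennreal_ofReal).mul (hρ.comp hsparse)

end FiberCount

section MixedVolumeCount

open Matrix MeasureTheory Set
open scoped ENNReal Pointwise

variable {n : ℕ} {κ : Fin n → Type} [∀ i, Fintype (κ i)]

lemma lintegral_pi_gaussian_eq_pi_pow (κ : Fin n → Type) [∀ i, Fintype (κ i)] :
    ∫⁻ c : ∀ i, κ i → ℂ, ENNReal.ofReal (Real.exp (-∑ i, ∑ k, ‖c i k‖ ^ 2)) =
      ENNReal.ofReal (Real.pi ^ ∑ i, Fintype.card (κ i)) := by
  have hI : ∀ i, ∫ b : κ i → ℂ, Real.exp (-∑ k, ‖b k‖ ^ 2) = Real.pi ^ Fintype.card (κ i) := by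
    intro i
    rw [integral_eq_lintegral_of_nonneg_ae (.of_forall fun b => (Real.exp_pos _).le)
      (Continuous.aestronglyMeasurable (by fun_prop)), lintegral_gaussian_eq_pi_pow,
      ENNReal.toReal_ofReal (by positivity)]
  have hintegrable : ∀ i, Integrable fun b : κ i → ℂ => Real.exp (-∑ k, ‖b k‖ ^ 2) := fun i =>
    .of_integral_ne_zero (by rw [hI]; positivity)
  have hprod : ∀ c : ∀ i, κ i → ℂ, Real.exp (-∑ i, ∑ k, ‖c i k‖ ^ 2) =
      ∏ i, Real.exp (-∑ k, ‖c i k‖ ^ 2) := fun c => by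
    rw [← Finset.sum_neg_distrib, Real.exp_sum]
  rw [← ofReal_integral_eq_lintegral_ofReal _ (.of_forall fun b => (Real.exp_pos _).le)]
  · simp only [hprod]
    rw [integral_fintype_prod_volume_eq_prod fun i (b : κ i → ℂ) => Real.exp (-∑ k, ‖b k‖ ^ 2)]
    simp only [hI, Finset.prod_pow_eq_pow_sum]
  · simp only [hprod]
    exact Integrable.fintype_prod_dep hintegrable

lemma lintegral_torusStrip_comp_re {g : (Fin n → ℝ) → ℝ≥0∞} (hg : Measurable g) :
    ∫⁻ z in torusStrip n, g (fun j => (z j).re) =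
      ENNReal.ofReal ((2 * Real.pi) ^ n) * ∫⁻ x, g x := by
  have h₁ : MeasurePreserving (fun (z : Fin n → ℂ) j => Complex.measurableEquivRealProd (z j)) :=
    volume_preserving_pi fun _ => Complex.volume_preserving_equiv_real_prod
  have h := (volume_measurePreserving_arrowProdEquivProdArrow ℝ ℝ (Fin n)).comp h₁
  have hemb : MeasurableEmbedding (⇑(MeasurableEquiv.arrowProdEquivProdArrow ℝ ℝ (Fin n)) ∘
      fun (z : Fin n → ℂ) j => Complex.measurableEquivRealProd (z j)) :=
    (MeasurableEquiv.measurableEmbedding _).comp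
      (MeasurableEquiv.piCongrRight fun _ : Fin n =>
        Complex.measurableEquivRealProd).measurableEmbedding
  have hstrip : torusStrip n = (⇑(MeasurableEquiv.arrowProdEquivProdArrow ℝ ℝ (Fin n)) ∘
      fun (z : Fin n → ℂ) j => Complex.measurableEquivRealProd (z j)) ⁻¹'
        (univ ×ˢ Set.pi univ fun _ => Ioc (-Real.pi) Real.pi) := by
    ext z
    simp only [torusStrip, mem_preimage, mem_prod, mem_univ, true_and, mem_pi, forall_const]
    rfl
  rw [hstrip]
  refine (h.setLIntegral_comp_preimage_emb hemb (fun p => g p.1) _).trans ?_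
  have hvol : (volume : Measure ((Fin n → ℝ) × (Fin n → ℝ))) = volume.prod volume := rfl
  rw [hvol, ← Measure.prod_restrict, Measure.restrict_univ, lintegral_prod _ (by fun_prop)]
  simp only [lintegral_const, Measure.restrict_apply_univ, volume_pi_pi, Real.volume_Ioc]
  rw [lintegral_mul_const _ hg, mul_comm, Finset.prod_const, Finset.card_univ, Fintype.card_fin,
    ENNReal.ofReal_pow (by positivity)]
  congr 4
  ring

lemma measurable_jacobianGaussian (q : ∀ i, κ i → Fin n → ℤ) :
    Measurable fun p : (∀ i, κ i → ℂ) × (Fin n → ℂ) => jacobianGaussian q p.2 p.1 := by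
  refine Continuous.measurable ?_
  have hdet := Complex.continuous_normSq.comp (continuous_det_logJacobian_torusExp q)
  have h := fun i k => (continuous_laurentMonomial_torusExp (q i k)).comp
    (continuous_snd (X := ∀ i, κ i → ℂ))
  simp only [Function.comp_def] at h hdet
  unfold jacobianGaussian dotProduct
  fun_prop

/-- The generic number of roots is the mixed volume. -/
theorem generic_root_count_eq_mixedVolume (q : ∀ i, κ i → Fin n → ℤ) {N : ℕ}
    (hN : ∀ᵐ c, ∀ᵐ b, (sparseRoots q c b).encard = N) :
    (N : ℝ) = ∑ S : Finset (Fin n), (-1 : ℝ) ^ (n - S.card) *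
      (volume (convexHull ℝ (∑ i ∈ S, range (consOrigin (q i))))).toReal := by
  set G : (Fin n → ℝ) → ℝ := fun x => ∑ S : Finset (Fin n), (-1 : ℝ) ^ (n - S.card) *
    (∑ i ∈ S, gibbsCov (consOrigin (q i)) x).det with hG
  set K := ∑ i, Fintype.card (κ i)
  have hGc : Continuous G := continuous_finsetSum _ fun S _ => continuous_const.mul
    (continuous_finsetSum S fun i _ => continuous_gibbsCov (consOrigin (q i))).matrix_det
  have hdet : ∀ (S : Finset (Fin n)) x, (∑ i ∈ S, gibbsCov (consOrigin (q i)) x).det =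
      (2 ^ n)⁻¹ * ((2 : ℝ) • ∑ i ∈ S, gibbsCov (consOrigin (q i)) x).det := fun S x => by
    rw [det_smul, Fintype.card_fin, inv_mul_cancel_left₀ (by positivity)]
  have hdetint : ∀ S : Finset (Fin n), Integrable fun x => (-1 : ℝ) ^ (n - S.card) *
      (∑ i ∈ S, gibbsCov (consOrigin (q i)) x).det := fun S => by
    simp only [hdet]
    exact ((integrable_det_sum_gibbsCov S fun i => consOrigin (q i)).const_mul _).const_mul _
  have hGint : Integrable G := integrable_finsetSum _ fun S _ => hdetint S
  have hGval : ∫ x, G x = (2 ^ n)⁻¹ * ∑ S : Finset (Fin n), (-1 : ℝ) ^ (n - S.card) *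
      (volume (convexHull ℝ (∑ i ∈ S, range (consOrigin (q i))))).toReal := by
    rw [hG, integral_finsetSum _ fun S _ => hdetint S, Finset.mul_sum]
    refine Finset.sum_congr rfl fun S _ => ?_
    simp only [hdet, integral_const_mul]
    rw [integral_det_sum_gibbsCov S fun i => consOrigin (q i)]
    ring
  have hJ : ∀ z c, 0 ≤ jacobianGaussian q z c := fun z c =>
    mul_nonneg (Complex.normSq_nonneg _) (Real.exp_pos _).le
  have hG0 : ∀ x, 0 ≤ G x := fun x => by
    have h := integral_nonneg (μ := volume) (f := jacobianGaussian q fun j => (x j : ℂ)) (hJ _)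
    rw [(integrable_and_integral_jacobianGaussian q _).2] at h
    exact nonneg_of_mul_nonneg_right h (by positivity)
  have hleft : ∫⁻ c, ∫⁻ z in torusStrip n, ENNReal.ofReal (jacobianGaussian q z c) =
      N * ENNReal.ofReal (Real.pi ^ n) * ENNReal.ofReal (Real.pi ^ K) := by
    rw [← lintegral_pi_gaussian_eq_pi_pow, ← lintegral_const_mul _ (by fun_prop)]
    refine lintegral_congr_ae ?_
    filter_upwards [hN] with c hc
    exact lintegral_jacobianGaussian_torusStrip q c hc
  have hright : ∫⁻ c, ∫⁻ z in torusStrip n, ENNReal.ofReal (jacobianGaussian q z c) =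
      ENNReal.ofReal ((2 * Real.pi) ^ n) * ENNReal.ofReal (Real.pi ^ K * ∫ x, G x) := by
    rw [lintegral_lintegral_swap (measurable_jacobianGaussian q).ennreal_ofReal.aemeasurable,
      ← integral_const_mul, ofReal_integral_eq_lintegral_ofReal (hGint.const_mul _)
        (.of_forall fun x => mul_nonneg (by positivity) (hG0 x)),
      ← lintegral_torusStrip_comp_re (by fun_prop)]
    refine lintegral_congr fun z => ?_
    have h := integrable_and_integral_jacobianGaussian q z
    rw [← ofReal_integral_eq_lintegral_ofReal h.1 (.of_forall (hJ z)), h.2]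
  have hmain := congrArg ENNReal.toReal (hleft.symm.trans hright)
  have hI : 0 ≤ ∫ x, G x := integral_nonneg hG0
  simp only [ENNReal.toReal_mul, ENNReal.toReal_natCast] at hmain
  rw [ENNReal.toReal_ofReal (by positivity), ENNReal.toReal_ofReal (by positivity),
    ENNReal.toReal_ofReal (by positivity), ENNReal.toReal_ofReal (by positivity), hGval,
    mul_pow] at hmain
  have hπ := Real.pi_pos
  field_simp at hmain
  exact hmain

/-- A generic sparse system has as many roots as the mixed volume of its Newton polytopes, all of
them nondegenerate. -/
theorem exists_generic_root_count_eq_mixedVolume (q : ∀ i, κ i → Fin n → ℤ) :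
    ∃ D : MvPolynomial ((Σ i, κ i) ⊕ Fin n) ℂ, D ≠ 0 ∧
      ∀ c b, MvPolynomial.eval (sparseCoeffs c b) D ≠ 0 →
        (sparseRoots q c b).Finite ∧
        ((sparseRoots q c b).ncard : ℝ) = ∑ S : Finset (Fin n), (-1 : ℝ) ^ (n - S.card) *
          (volume (convexHull ℝ (∑ i ∈ S, range (consOrigin (q i))))).toReal ∧
        ∀ t ∈ sparseRoots q c b, (logJacobian q c t).det ≠ 0 := by
  obtain ⟨D, hD, N, hDN, hJ⟩ := exists_generic_root_count q
  let L : (∀ i, κ i → ℂ) × (Fin n → ℂ) →ₗ[ℝ] ((Σ i, κ i) ⊕ Fin n → ℂ) :=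
    { toFun := fun p => sparseCoeffs p.1 p.2
      map_add' := fun p p' => by
        ext (i | i) <;> rfl
      map_smul' := fun a p => by
        ext (i | i) <;> rfl }
  have hL : Function.Surjective L := fun f =>
    ⟨(fun i k => f (.inl ⟨i, k⟩), fun i => f (.inr i)), by ext (i | i) <;> rfl⟩
  have hN : ∀ᵐ c, ∀ᵐ b, (sparseRoots q c b).encard = N := by
    have hpi : (volume : Measure (∀ i, κ i → ℂ)).IsAddHaarMeasure := Measure.pi.isAddHaarMeasure _
    have := Measure.prod.instIsAddHaarMeasure (volume : Measure (∀ i, κ i → ℂ))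
      (volume : Measure (Fin n → ℂ))
    have h := Measure.ae_ae_of_ae_prod (ae_eval_linearMap_ne_zero (volume.prod volume) L hL hD)
    filter_upwards [h] with c hc
    filter_upwards [hc] with b hb
    obtain ⟨hfin, hcard⟩ := hDN c b hb
    rw [← hfin.cast_ncard_eq, hcard]
  have hvol := generic_root_count_eq_mixedVolume q hN
  refine ⟨D, hD, fun c b hcb => ⟨(hDN c b hcb).1, by rw [(hDN c b hcb).2, hvol], ?_⟩⟩
  obtain hJ | hJ := hJ
  swap
  · exact hJ c b hcb
  have hN0 : N = 0 := by
    obtain ⟨c', hc'⟩ := hN.exists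
    have h := lintegral_jacobianGaussian_torusStrip q c' hc'
    simp only [jacobianGaussian, hJ, map_zero, zero_mul, ENNReal.ofReal_zero,
      lintegral_zero] at h
    have hπ : (0 : ℝ) < Real.pi ^ n := by positivity
    simpa [hπ.not_ge, (Real.exp_pos _).not_ge] using h.symm
  obtain ⟨hfin, hcard⟩ := hDN c b hcb
  rw [hN0, ncard_eq_zero hfin] at hcard
  simp [hcard]

end MixedVolumeCount

open scoped BigOperators Pointwise

section NewtonPolytopes

open MeasureTheory

variable {n : ℕ}

lemma image_intCast_eq_singleton_add_range_consOrigin (A : Finset (Fin n → ℤ))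
    {a : Fin n → ℤ} (ha : a ∈ A) :
    (fun (m : Fin n → ℤ) j => (m j : ℝ)) '' A =
      {fun j => (a j : ℝ)} + Set.range (consOrigin fun k : A.erase a => (k : Fin n → ℤ) - a) := by
  ext x
  simp only [Set.mem_image, Set.singleton_add, ← Set.range_comp, Set.mem_range, Option.exists,
    Function.comp_apply]
  constructor
  · rintro ⟨m, hm, rfl⟩
    by_cases hma : m = a
    · exact .inl (by simp [consOrigin, hma])
    · refine .inr ⟨⟨m, Finset.mem_erase.2 ⟨hma, hm⟩⟩, ?_⟩
      ext j
      simp [consOrigin]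
  · rintro (rfl | ⟨k, rfl⟩)
    · exact ⟨a, ha, by simp [consOrigin]⟩
    · refine ⟨k, Finset.mem_of_mem_erase k.2, ?_⟩
      ext j
      simp [consOrigin]

lemma volume_convexHull_sum_eq_consOrigin (A : Fin n → Finset (Fin n → ℤ))
    {a : Fin n → Fin n → ℤ} (ha : ∀ i, a i ∈ A i) (S : Finset (Fin n)) :
    volume (convexHull ℝ ((fun (m : Fin n → ℤ) j => (m j : ℝ)) '' ↑(∑ i ∈ S, A i))) =
      volume (convexHull ℝ (∑ i ∈ S,
        Set.range (consOrigin fun k : (A i).erase (a i) => (k : Fin n → ℤ) - a i))) := by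
  have himage : (fun (m : Fin n → ℤ) j => (m j : ℝ)) '' ↑(∑ i ∈ S, A i) =
      ∑ i ∈ S, (fun (m : Fin n → ℤ) j => (m j : ℝ)) '' (A i : Set (Fin n → ℤ)) := by
    rw [Finset.coe_sum]
    exact Set.image_finsetSum ((Int.castAddHom ℝ).compLeft (Fin n)) _ _
  rw [himage, Finset.sum_congr rfl fun i _ =>
    image_intCast_eq_singleton_add_range_consOrigin (A i) (ha i), Finset.sum_add_distrib,
    Set.finsetSum_singleton, convexHull_add, convexHull_singleton, Set.singleton_add,
    Set.image_add_left, measure_preimage_add]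

lemma volume_convexHull_empty_sum (hn : 0 < n) (p : Fin n → Set (Fin n → ℝ)) :
    volume (convexHull ℝ (∑ i ∈ (∅ : Finset (Fin n)), p i)) = 0 := by
  have : Nonempty (Fin n) := ⟨⟨0, hn⟩⟩
  rw [Finset.sum_empty, ← Set.singleton_zero, convexHull_singleton, measure_singleton]

lemma laurentMonomial_add (t : Fin n → ℂˣ) (m m' : Fin n → ℤ) :
    laurentMonomial t (m + m') = laurentMonomial t m * laurentMonomial t m' := by
  simp only [laurentMonomial, Pi.add_apply, zpow_add, Finset.prod_mul_distrib, Units.val_mul]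

lemma laurentMonomial_ne_zero (t : Fin n → ℂˣ) (m : Fin n → ℤ) : laurentMonomial t m ≠ 0 :=
  Units.ne_zero _

lemma sum_mul_laurentMonomial_eq (A : Finset (Fin n → ℤ)) {a : Fin n → ℤ} (ha : a ∈ A)
    (c : (Fin n → ℤ) → ℂ) (t : Fin n → ℂˣ) :
    ∑ m ∈ A, c m * laurentMonomial t m = laurentMonomial t a *
      (c a + ∑ k : A.erase a, c k * laurentMonomial t (k - a)) := by
  rw [← Finset.add_sum_erase A _ ha, mul_add, mul_comm, Finset.mul_sum,
    Finset.sum_coe_sort (A.erase a) fun k =>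
      laurentMonomial t a * (c k * laurentMonomial t (k - a))]
  congr 1
  refine Finset.sum_congr rfl fun k _ => ?_
  rw [mul_left_comm, ← laurentMonomial_add, add_sub_cancel]

end NewtonPolytopes

/-- The BKK theorem: for generic coefficients, the sparse system with supports
𝒜₁,…,𝒜_n has exactly MV(𝒫₁,…,𝒫_n) solutions in (ℂˣ)ⁿ (mixed volume via
inclusion–exclusion of Lebesgue volumes of convex hulls of Minkowski sums), and the
Jacobian is invertible at each solution. -/
theorem stmt_8
    (n : ℕ) (hn : 0 < n)
    (𝒜 : Fin n → Finset (Fin n → ℤ))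
    (h𝒜 : ∀ i, (𝒜 i).Nonempty)
    (hdim : affineSpan ℝ
        ((fun m : Fin n → ℤ => fun j => (m j : ℝ)) '' ↑(∑ i, 𝒜 i)) = ⊤) :
    ∃ D : MvPolynomial (Fin n × (Fin n → ℤ)) ℂ, D ≠ 0 ∧
      ∀ c : Fin n → (Fin n → ℤ) → ℂ,
        MvPolynomial.eval (fun p => c p.1 p.2) D ≠ 0 →
          {t : Fin n → ℂˣ |
              ∀ i, ∑ m ∈ 𝒜 i, c i m * ((∏ j, t j ^ m j : ℂˣ) : ℂ) = 0}.Finite ∧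
          (Nat.card {t : Fin n → ℂˣ |
              ∀ i, ∑ m ∈ 𝒜 i, c i m * ((∏ j, t j ^ m j : ℂˣ) : ℂ) = 0} : ℝ)
            = ∑ S ∈ Finset.univ.powerset.filter (fun S : Finset (Fin n) => S.Nonempty),
                (-1 : ℝ) ^ (n - S.card) *
                  (MeasureTheory.volume (convexHull ℝ
                    ((fun m : Fin n → ℤ => fun j => (m j : ℝ)) ''
                      ↑(∑ i ∈ S, 𝒜 i)))).toReal ∧
          ∀ t ∈ {t : Fin n → ℂˣ |
              ∀ i, ∑ m ∈ 𝒜 i, c i m * ((∏ j, t j ^ m j : ℂˣ) : ℂ) = 0},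
            (Matrix.of fun i j : Fin n =>
                ∑ m ∈ 𝒜 i, c i m * (m j : ℂ) *
                  ((∏ l, t l ^ (m l - if l = j then 1 else 0) : ℂˣ) : ℂ)).det ≠ 0 := by
  choose a ha using h𝒜
  let κ : Fin n → Type := fun i => (𝒜 i).erase (a i)
  let q : ∀ i, κ i → Fin n → ℤ := fun i k => k.1 - a i
  obtain ⟨D, hD, hDc⟩ := exists_generic_root_count_eq_mixedVolume q
  let ι : (Σ i, κ i) ⊕ Fin n → Fin n × (Fin n → ℤ) :=
    Sum.elim (fun p => (p.1, p.2.1)) fun i => (i, a i)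
  have hι : Function.Injective ι := by
    rintro (⟨i, k⟩ | i) (⟨i', k'⟩ | i') h <;> obtain ⟨rfl, h⟩ := Prod.mk.inj h
    · obtain rfl := Subtype.ext h
      rfl
    · exact absurd h (Finset.ne_of_mem_erase k.2)
    · exact absurd h.symm (Finset.ne_of_mem_erase k'.2)
    · rfl
  refine ⟨MvPolynomial.rename ι D,
    fun h => hD (MvPolynomial.rename_injective ι hι (h.trans (map_zero _).symm)), fun c hc => ?_⟩
  have hroots : {t : Fin n → ℂˣ |
      ∀ i, ∑ m ∈ 𝒜 i, c i m * ((∏ j, t j ^ m j : ℂˣ) : ℂ) = 0} =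
        sparseRoots q (fun i k => c i k.1) fun i => c i (a i) := by
    ext t
    refine forall_congr' fun i => ?_
    refine Eq.congr_left (sum_mul_laurentMonomial_eq (𝒜 i) (ha i) (c i) t) |>.trans ?_
    rw [mul_eq_zero, or_iff_right (laurentMonomial_ne_zero t (a i))]
  have heval : (fun p : Fin n × (Fin n → ℤ) => c p.1 p.2) ∘ ι =
      sparseCoeffs (fun i (k : κ i) => c i k.1) fun i => c i (a i) := by
    ext (p | i) <;> rfl
  rw [MvPolynomial.eval_rename, heval] at hc
  obtain ⟨hfin, hcard, hJ⟩ := hDc _ _ hc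
  rw [hroots]
  refine ⟨hfin, ?_, fun t ht => ?_⟩
  · rw [Nat.card_coe_set_eq, hcard, Finset.powerset_univ, Finset.sum_filter]
    refine Finset.sum_congr rfl fun S _ => ?_
    rw [volume_convexHull_sum_eq_consOrigin 𝒜 ha S]
    split_ifs with hS
    · rfl
    · rw [Finset.not_nonempty_iff_eq_empty.1 hS, volume_convexHull_empty_sum hn,
        ENNReal.toReal_zero, mul_zero]
  · have hmat : (Matrix.of fun i j : Fin n => ∑ m ∈ 𝒜 i, c i m * (m j : ℂ) *
        ((∏ l, t l ^ (m l - if l = j then 1 else 0) : ℂˣ) : ℂ)) =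
        Matrix.diagonal (fun i => laurentMonomial t (a i)) *
          logJacobian q (fun i k => c i k.1) t * Matrix.diagonal fun j => ((t j)⁻¹ : ℂ) := by
      ext i j
      have hshift : ∀ m : Fin n → ℤ,
          ((∏ l, t l ^ (m l - if l = j then 1 else 0) : ℂˣ) : ℂ) =
            laurentMonomial t m * ((t j)⁻¹ : ℂ) := fun m => by
        have hj : ∏ l, t l ^ (if l = j then 1 else 0 : ℤ) = t j := by
          rw [Finset.prod_eq_single j (fun l _ hl => by simp [hl]) (by simp)]
          simp
        simp only [zpow_sub, Finset.prod_mul_distrib, Finset.prod_inv_distrib, hj,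
          laurentMonomial, Units.val_mul, Units.val_inv_eq_inv_val]
      have hsum := sum_mul_laurentMonomial_eq (𝒜 i) (ha i) (fun m => c i m * m j) t
      have hroot : c i (a i) + ∑ k : κ i, c i k.1 * laurentMonomial t (q i k) = 0 := ht i
      have hq : ∑ k : κ i, c i k.1 * q i k j * laurentMonomial t (q i k) =
          ∑ k : κ i, c i k.1 * k.1 j * laurentMonomial t (q i k) -
            a i j * ∑ k : κ i, c i k.1 * laurentMonomial t (q i k) := by
        rw [Finset.mul_sum, ← Finset.sum_sub_distrib]
        refine Finset.sum_congr rfl fun k _ => ?_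
        rw [show q i k j = k.1 j - a i j from rfl]
        push_cast
        ring
      rw [Matrix.mul_diagonal, Matrix.diagonal_mul]
      simp only [Matrix.of_apply, hshift, ← mul_assoc, ← Finset.sum_mul, hsum, logJacobian]
      rw [hq]
      congr 2
      linear_combination (a i j : ℂ) * hroot
    rw [hmat, Matrix.det_mul, Matrix.det_mul, Matrix.det_diagonal, Matrix.det_diagonal]
    refine mul_ne_zero (mul_ne_zero ?_ (hJ t ht)) ?_
    · exact Finset.prod_ne_zero_iff.2 fun i _ => laurentMonomial_ne_zero t (a i)
    · exact Finset.prod_ne_zero_iff.2 fun j _ => inv_ne_zero (t j).ne_zero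
end
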